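/- Let p, q be relatively prime positive integers, {F_n} the (p,q)-Fibonacci sequence, and let h, a, d be positive integers and n ≥ 3. Set d_1 = F_a and d_i = F_{h·a + (i−1)·d} for 2 ≤ i ≤ n, and A = {d_1, …, d_n}. Then the toric ideal I_A is a complete intersection if and only if one of the following holds: (a) d is odd; (b) d ≥ a; (c) a = 2d; (d) gcd(a, d) = a − d and a is odd; or (e) n = 3 and 2d divides a. -/

import Mathlib

open MvPolynomial

/-- The `(p,q)`-Fibonacci sequence: `F 0 = 0`, `F 1 = 1`, `F (n+2) = p * F (n+1) + q * F n`. -/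
def pqFib (p q : ℕ) : ℕ → ℕ
  | 0 => 0
  | 1 => 1
  | n + 2 => p * pqFib p q (n + 1) + q * pqFib p q n

/-- The `(p,q)`-Lucas sequence: `L 0 = 2`, `L 1 = p`, `L (n+2) = p * L (n+1) + q * L n`. -/
def pqLucas (p q : ℕ) : ℕ → ℕ
  | 0 => 2
  | 1 => p
  | n + 2 => p * pqLucas p q (n + 1) + q * pqLucas p q n

/-- The toric ideal of the affine monomial curve `t ↦ (t^{d 0}, …, t^{d (n-1)})`:
the kernel of the `k`-algebra map `k[x_1,…,x_n] → k[t]`, `x_i ↦ t^{d i}`. -/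
noncomputable def toricIdeal (k : Type*) [Field k] {n : ℕ} (d : Fin n → ℕ) :
    Ideal (MvPolynomial (Fin n) k) :=
  RingHom.ker (MvPolynomial.aeval
    (fun i : Fin n => (Polynomial.X : Polynomial k) ^ d i)).toRingHom

/-- The toric ideal `I_A` is a complete intersection iff it can be generated by
`n - 1` elements. -/
def IsCI (k : Type*) [Field k] {n : ℕ} (d : Fin n → ℕ) : Prop :=
  ∃ g : Fin (n - 1) → MvPolynomial (Fin n) k,
    Ideal.span (Set.range g) = toricIdeal k d

/-- The toric ideal of the projective monomial curve: the kernel of the `k`-algebra map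
`k[x_1,…,x_{n+1}] → k[t,u]`, `x_i ↦ t^{d i} u^{D - d i}` for `i ≤ n` and
`x_{n+1} ↦ u^D`, where `D = max A`. -/
noncomputable def projToricIdeal (k : Type*) [Field k] {n : ℕ} (d : Fin n → ℕ) :
    Ideal (MvPolynomial (Fin (n + 1)) k) :=
  RingHom.ker (MvPolynomial.aeval (fun i : Fin (n + 1) =>
    if h : (i : ℕ) < n then
      (X 0 : MvPolynomial (Fin 2) k) ^ d ⟨i, h⟩ *
        (X 1 : MvPolynomial (Fin 2) k) ^ (Finset.univ.sup d - d ⟨i, h⟩)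
    else (X 1 : MvPolynomial (Fin 2) k) ^ (Finset.univ.sup d))).toRingHom

/-- The projective toric ideal `I_{A*}` is a complete intersection iff it can be
generated by `n - 1` elements. -/
def ProjIsCI (k : Type*) [Field k] {n : ℕ} (d : Fin n → ℕ) : Prop :=
  ∃ g : Fin (n - 1) → MvPolynomial (Fin (n + 1)) k,
    Ideal.span (Set.range g) = projToricIdeal k d

/-- `d 0 < d 1 < ⋯` is a generalized arithmetic sequence: there are positive
integers `h, e` with `d i = h * d 0 + i * e` for every `i ≥ 1`. -/
def IsGenArith {n : ℕ} (d : Fin n → ℕ) : Prop :=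
  ∃ h e : ℕ, 0 < h ∧ 0 < e ∧
    ∀ i : Fin n, 0 < (i : ℕ) → d i = h * d ⟨0, i.pos⟩ + (i : ℕ) * e

/-- `d 0 < d 1 < ⋯` is an increasing arithmetic sequence: there is a positive
integer `e` with `d i = d 0 + i * e` for every `i`. -/
def IsArithFn {n : ℕ} (d : Fin n → ℕ) : Prop :=
  ∃ e : ℕ, 0 < e ∧ ∀ i : Fin n, 0 < (i : ℕ) → d i = d ⟨0, i.pos⟩ + (i : ℕ) * e

/-- `A = {d 0, …, d (n-1)}` minimally generates the numerical semigroup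
`ℕ d 0 + ⋯ + ℕ d (n-1)`: no `d i` lies in the subsemigroup generated by the rest. -/
def MinimallyGenerates {n : ℕ} (d : Fin n → ℕ) : Prop :=
  ∀ i : Fin n, ¬ ∃ α : Fin n → ℕ, α i = 0 ∧ d i = ∑ j, α j * d j


open MvPolynomial

/-! ### Toric algebra -/

lemma aeval_monomial_toric (k : Type*) [Field k] {n : ℕ} (D : Fin n → ℕ) (u : Fin n →₀ ℕ) (c : k) :
    MvPolynomial.aeval (fun i : Fin n => (Polynomial.X : Polynomial k) ^ D i) (monomial u c) =
      Polynomial.monomial (Finsupp.weight D u) c := by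
  rw [MvPolynomial.aeval_monomial, ← Polynomial.C_mul_X_pow_eq_monomial]
  congr 1
  rw [Finsupp.weight_apply, Finsupp.prod, Finsupp.sum, ← Finset.prod_pow_eq_pow_sum]
  refine Finset.prod_congr rfl fun i _ => ?_
  rw [← pow_mul, smul_eq_mul, mul_comm]

lemma mem_toric (k : Type*) [Field k] {n : ℕ} (D : Fin n → ℕ) (f : MvPolynomial (Fin n) k) :
    f ∈ toricIdeal k D ↔
      MvPolynomial.aeval (fun i : Fin n => (Polynomial.X : Polynomial k) ^ D i) f = 0 := by
  rfl

lemma binom_mem_toric (k : Type*) [Field k] {n : ℕ} (D : Fin n → ℕ) (u v : Fin n →₀ ℕ)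
    (h : Finsupp.weight D u = Finsupp.weight D v) :
    (monomial u 1 - monomial v 1 : MvPolynomial (Fin n) k) ∈ toricIdeal k D := by
  rw [mem_toric, map_sub, aeval_monomial_toric, aeval_monomial_toric, h, sub_self]

/-- factor through the degree -/
lemma toric_factor (k : Type*) [Field k] {n : ℕ} (D : Fin n → ℕ) {V : Type*} [AddCommGroup V]
    [Module k V] (T : MvPolynomial (Fin n) k →ₗ[k] V)
    (hT : ∀ u v : Fin n →₀ ℕ, Finsupp.weight D u = Finsupp.weight D v →
      T (monomial u 1) = T (monomial v 1))
    (f : MvPolynomial (Fin n) k) (hf : f ∈ toricIdeal k D) : T f = 0 := by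
  classical
  let Λ : Polynomial k →ₗ[k] V := (Polynomial.basisMonomials k).constr k
    (fun m => if h : ∃ u : Fin n →₀ ℕ, Finsupp.weight D u = m then T (monomial h.choose 1) else 0)
  have key : T = Λ ∘ₗ (MvPolynomial.aeval
      (fun i : Fin n => (Polynomial.X : Polynomial k) ^ D i)).toLinearMap := by
    refine (MvPolynomial.basisMonomials (Fin n) k).ext fun u => ?_
    simp only [MvPolynomial.coe_basisMonomials, LinearMap.comp_apply, AlgHom.toLinearMap_apply]
    rw [aeval_monomial_toric]
    have : (Polynomial.monomial (Finsupp.weight D u) (1 : k)) =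
      Polynomial.basisMonomials k (Finsupp.weight D u) := by simp
    rw [this, Module.Basis.constr_basis]
    have hex : ∃ v : Fin n →₀ ℕ, Finsupp.weight D v = Finsupp.weight D u := ⟨u, rfl⟩
    rw [dif_pos hex]
    exact hT _ _ hex.choose_spec.symm
  rw [key, LinearMap.comp_apply, AlgHom.toLinearMap_apply, (mem_toric k D f).1 hf, map_zero]

lemma suf_CI (k : Type*) [Field k] {n : ℕ} (D : Fin n → ℕ)
    (g : Fin (n - 1) → MvPolynomial (Fin n) k) (hg : ∀ i, g i ∈ toricIdeal k D)
    (hb : ∀ u v : Fin n →₀ ℕ, Finsupp.weight D u = Finsupp.weight D v →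
      (monomial u 1 - monomial v 1 : MvPolynomial (Fin n) k) ∈ Ideal.span (Set.range g)) :
    IsCI k D := by
  refine ⟨g, le_antisymm ?_ ?_⟩
  · rw [Ideal.span_le]
    rintro _ ⟨i, rfl⟩
    exact hg i
  · intro f hf
    have := toric_factor k D (Ideal.Quotient.mkₐ k (Ideal.span (Set.range g))).toLinearMap
      (fun u v h => by
        simp only [AlgHom.toLinearMap_apply, Ideal.Quotient.mkₐ_eq_mk]
        exact Ideal.Quotient.eq.2 (hb u v h)) f hf
    simp only [AlgHom.toLinearMap_apply, Ideal.Quotient.mkₐ_eq_mk] at this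
    exact Ideal.Quotient.eq_zero_iff_mem.1 this

/-- `C` is closed under moves inside a fibre along monomials sharing a variable. -/
def FibClosed {n : ℕ} (D : Fin n → ℕ) (C : Set (Fin n →₀ ℕ)) : Prop :=
  ∀ u v : Fin n →₀ ℕ, Finsupp.weight D u = Finsupp.weight D v → ∀ l, 0 < u l → 0 < v l →
    u ∈ C → v ∈ C

open Classical in
noncomputable def phiC (k : Type*) [Field k] {n : ℕ} (C : Set (Fin n →₀ ℕ)) :
    MvPolynomial (Fin n) k →ₗ[k] k :=
  (MvPolynomial.basisMonomials (Fin n) k).constr k (fun u => if u ∈ C then 1 else 0)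

open Classical in
lemma phiC_monomial (k : Type*) [Field k] {n : ℕ} (C : Set (Fin n →₀ ℕ)) (u : Fin n →₀ ℕ) :
    phiC k C (monomial u 1) = if u ∈ C then 1 else 0 := by
  have : (monomial u (1 : k)) = MvPolynomial.basisMonomials (Fin n) k u := by simp
  rw [this, phiC, Module.Basis.constr_basis]

lemma phiC_X_mul (k : Type*) [Field k] {n : ℕ} (D : Fin n → ℕ) (C : Set (Fin n →₀ ℕ))
    (hC : FibClosed D C) (l : Fin n) (f : MvPolynomial (Fin n) k) (hf : f ∈ toricIdeal k D) :
    phiC k C (X l * f) = 0 := by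
  classical
  have := toric_factor k D ((phiC k C) ∘ₗ (LinearMap.mulLeft k (X l : MvPolynomial (Fin n) k)))
    (fun u v h => by
      simp only [LinearMap.comp_apply, LinearMap.mulLeft_apply]
      have e : ∀ w : Fin n →₀ ℕ, (X l * monomial w 1 : MvPolynomial (Fin n) k) =
          monomial (Finsupp.single l 1 + w) 1 := by
        intro w
        rw [X, monomial_mul, one_mul]
      rw [e, e, phiC_monomial, phiC_monomial]
      have hw : Finsupp.weight D (Finsupp.single l 1 + u) =
          Finsupp.weight D (Finsupp.single l 1 + v) := by
        rw [map_add, map_add, h]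
      congr 1
      exact propext ⟨hC _ _ hw l (by simp) (by simp), hC _ _ hw.symm l (by simp) (by simp)⟩) f hf
  simpa using this

lemma phiC_mul (k : Type*) [Field k] {n : ℕ} (D : Fin n → ℕ) (C : Set (Fin n →₀ ℕ))
    (hC : FibClosed D C) (r f : MvPolynomial (Fin n) k) (hf : f ∈ toricIdeal k D) :
    phiC k C (r * f) = constantCoeff r * phiC k C f := by
  induction r using MvPolynomial.induction_on with
  | C a => simp [← MvPolynomial.smul_eq_C_mul]
  | add p q hp hq => simp [add_mul, hp, hq]
  | mul_X p i hp =>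
    have : p * X i * f = X i * (p * f) := by ring
    rw [this, phiC_X_mul k D C hC i _ (Ideal.mul_mem_left _ _ hf)]
    simp

lemma not_CI (k : Type*) [Field k] {n : ℕ} (hn : 0 < n) (D : Fin n → ℕ)
    (C : Fin n → Set (Fin n →₀ ℕ)) (hC : ∀ i, FibClosed D (C i)) (w v : Fin n → (Fin n →₀ ℕ))
    (hwv : ∀ i, Finsupp.weight D (w i) = Finsupp.weight D (v i))
    (hw : ∀ i, w i ∈ C i) (hv : ∀ i, v i ∉ C i)
    (hne : ∀ i j, i ≠ j → (w i ∈ C j ↔ v i ∈ C j)) : ¬ IsCI k D := by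
  classical
  rintro ⟨g, hg⟩
  let Φ : MvPolynomial (Fin n) k →ₗ[k] (Fin n → k) := LinearMap.pi fun i => phiC k (C i)
  let W : Submodule k (Fin n → k) := Submodule.span k (Set.range fun j => Φ (g j))
  have hmul : ∀ r f, f ∈ toricIdeal k D → Φ (r * f) = constantCoeff r • Φ f := by
    intro r f hf
    ext i
    simpa [Φ] using phiC_mul k D (C i) (hC i) r f hf
  have hall : ∀ f ∈ Ideal.span (Set.range g), Φ f ∈ W := by
    intro f hf
    refine Submodule.span_induction (p := fun f _ => Φ f ∈ W) ?_ ?_ ?_ ?_ hf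
    · rintro _ ⟨j, rfl⟩
      exact Submodule.subset_span ⟨j, rfl⟩
    · simp
    · intro x y _ _ hx hy
      rw [map_add]
      exact W.add_mem hx hy
    · intro r x hx hx'
      rw [smul_eq_mul, hmul r x (by rw [← hg]; exact hx)]
      exact W.smul_mem _ hx'
  have htop : W = ⊤ := by
    rw [eq_top_iff, ← (Pi.basisFun k (Fin n)).span_eq, Submodule.span_le]
    rintro _ ⟨i, rfl⟩
    have h1 : Φ (monomial (w i) 1 - monomial (v i) 1) = Pi.basisFun k (Fin n) i := by
      ext j
      simp only [Φ, LinearMap.pi_apply, map_sub, phiC_monomial, Pi.basisFun_apply]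
      by_cases hij : i = j
      · subst hij
        simp [hw, hv]
      · rw [if_congr (hne i j hij) rfl rfl, sub_self, Pi.single_eq_of_ne (Ne.symm hij)]
    rw [← h1]
    apply hall
    rw [hg]
    exact binom_mem_toric k D _ _ (hwv i)
  have h1 : Module.finrank k W ≤ Fintype.card (Fin (n - 1)) := finrank_range_le_card _
  rw [htop, finrank_top, Module.finrank_fintype_fun_eq_card, Fintype.card_fin, Fintype.card_fin] at h1
  omega



/-! ### Fibonacci -/
section Fib
variable {p q : ℕ}

lemma F_zero : pqFib p q 0 = 0 := rfl
lemma F_one : pqFib p q 1 = 1 := rfl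
lemma F_two_step (n : ℕ) : pqFib p q (n + 2) = p * pqFib p q (n + 1) + q * pqFib p q n := rfl

lemma F_add (m n : ℕ) : pqFib p q (m + n + 1) =
    pqFib p q (m + 1) * pqFib p q (n + 1) + q * (pqFib p q m * pqFib p q n) := by
  induction n using Nat.twoStepInduction generalizing m with
  | zero => simp [F_zero, F_one]
  | one => rw [show m + 1 + 1 = m + 2 from rfl, F_two_step, F_two_step, F_one, F_zero]; ring
  | more n h0 h1 =>
    rw [show m + (n + 2) + 1 = (m + n + 1) + 2 by ring, F_two_step,
      show m + n + 1 + 1 = m + (n + 1) + 1 by ring, h0, h1, F_two_step n,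
      show n + 2 + 1 = (n + 1) + 2 from rfl, F_two_step (n + 1), show n + 1 + 1 = n + 2 from rfl,
      F_two_step n]
    ring

lemma F_pos (hp : 0 < p) {n : ℕ} (hn : 0 < n) : 0 < pqFib p q n := by
  induction n using Nat.twoStepInduction with
  | zero => omega
  | one => simp [F_one]
  | more n h0 h1 =>
    rw [F_two_step]
    have := h1 (by omega)
    positivity

lemma F_le_succ (hp : 0 < p) (n : ℕ) : pqFib p q n ≤ pqFib p q (n + 1) := by
  cases n with
  | zero => simp [F_zero]
  | succ n => rw [F_two_step]; nlinarith [Nat.zero_le (q * pqFib p q n)]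

lemma F_mono (hp : 0 < p) : Monotone (pqFib p q) := monotone_nat_of_le_succ (F_le_succ hp)

lemma F_lt (hp : 0 < p) (hq : 0 < q) {m n : ℕ} (hm : 2 ≤ m) (h : m < n) :
    pqFib p q m < pqFib p q n := by
  refine lt_of_lt_of_le ?_ (F_mono hp (Nat.succ_le_of_lt h))
  obtain ⟨m, rfl⟩ : ∃ m', m = m' + 1 := ⟨m - 1, by omega⟩
  have h1 : 0 < q * pqFib p q m := Nat.mul_pos hq (F_pos hp (by omega))
  rw [Nat.succ_eq_add_one, show m + 1 + 1 = m + 2 from rfl, F_two_step]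
  nlinarith

lemma F_vajda (n i j : ℕ) : (pqFib p q (n + i) : ℤ) * pqFib p q (n + j) =
    pqFib p q n * pqFib p q (n + i + j) + (-q : ℤ) ^ n * (pqFib p q i * pqFib p q j) := by
  induction n with
  | zero => simp [F_zero]
  | succ n ih =>
    have h1 : pqFib p q (n + i + (n + j) + 1) = _ := F_add (n + i) (n + j)
    have h2 : pqFib p q (n + (n + i + j) + 1) = _ := F_add n (n + i + j)
    rw [show n + (n + i + j) + 1 = n + i + (n + j) + 1 by ring, h1] at h2
    have h2 := congrArg (Nat.cast (R := ℤ)) h2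
    push_cast at h2
    rw [show n + 1 + i = n + i + 1 by ring, show n + 1 + j = n + j + 1 by ring,
      show n + i + 1 + j = n + i + j + 1 by ring, pow_succ]
    linear_combination h2 - q * ih

lemma L_eq (n : ℕ) : pqLucas p q (n + 1) = pqFib p q (n + 2) + q * pqFib p q n := by
  induction n using Nat.twoStepInduction with
  | zero => simp [pqLucas, F_zero, F_two_step, F_one]
  | one => simp [pqLucas, F_zero, F_two_step, F_one]; ring
  | more n h0 h1 =>
    rw [show n + 2 + 1 = (n + 1) + 2 from rfl, pqLucas, h1, h0, F_two_step (n + 2),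
      F_two_step n, show n + 1 + 2 = n + 2 + 1 from rfl]
    ring_nf

lemma L_rec (m d : ℕ) (hd : 0 < d) : (pqFib p q (m + 2 * d) : ℤ) + (-q : ℤ) ^ d * pqFib p q m =
    pqLucas p q d * pqFib p q (m + d) := by
  obtain ⟨e, rfl⟩ : ∃ e, d = e + 1 := ⟨d - 1, by omega⟩
  rw [L_eq]
  have h1 := F_add (p := p) (q := q) (m + (e + 1)) e
  rw [show m + (e + 1) + e + 1 = m + 2 * (e + 1) by ring] at h1
  rw [h1]
  have h2 := F_vajda (p := p) (q := q) (e + 1) 1 m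
  rw [show e + 1 + 1 + m = m + (e + 1) + 1 by ring, show e + 1 + m = m + (e + 1) by ring, F_one,
    show e + 1 + 1 = e + 2 from rfl] at h2
  push_cast at h2 ⊢
  linear_combination -h2

lemma LF_mul (s g : ℕ) (hd : 0 < g + s) :
    (pqLucas p q (g + s) : ℤ) * pqFib p q g + (-q : ℤ) ^ g * pqFib p q s =
    pqFib p q (g + s + g) := by
  obtain ⟨e, he⟩ : ∃ e, g + s = e + 1 := ⟨g + s - 1, by omega⟩
  rw [he, L_eq]
  have h1 := F_add (p := p) (q := q) e g
  rw [show e + g + 1 = e + 1 + g by ring] at h1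
  rw [h1]
  have h2 := F_vajda (p := p) (q := q) g 1 s
  rw [show g + 1 + s = (g + s) + 1 by ring, he, F_one] at h2
  push_cast at h2 ⊢
  linear_combination -h2

lemma L_rec_even (m d : ℕ) (hd : 0 < d) (he : Even d) :
    pqFib p q (m + 2 * d) + q ^ d * pqFib p q m = pqLucas p q d * pqFib p q (m + d) := by
  have := L_rec (p := p) (q := q) m d hd
  rw [he.neg_pow] at this
  exact_mod_cast this

lemma L_rec_odd (m d : ℕ) (he : Odd d) :
    pqFib p q (m + 2 * d) = pqLucas p q d * pqFib p q (m + d) + q ^ d * pqFib p q m := by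
  have := L_rec (p := p) (q := q) m d he.pos
  rw [he.neg_pow] at this
  zify
  linarith

lemma L_mul_even (s g : ℕ) (hd : 0 < g + s) (he : Even g) :
    pqLucas p q (g + s) * pqFib p q g + q ^ g * pqFib p q s = pqFib p q (g + s + g) := by
  have := LF_mul (p := p) (q := q) s g hd
  rw [he.neg_pow] at this
  exact_mod_cast this

lemma L_mul_odd (s g : ℕ) (he : Odd g) :
    pqLucas p q (g + s) * pqFib p q g = pqFib p q (g + s + g) + q ^ g * pqFib p q s := by
  have := LF_mul (p := p) (q := q) s g (by have := he.pos; omega)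
  rw [he.neg_pow] at this
  zify
  linarith

lemma F_vajda_even (n i j : ℕ) (he : Even n) : pqFib p q (n + i) * pqFib p q (n + j) =
    pqFib p q n * pqFib p q (n + i + j) + q ^ n * (pqFib p q i * pqFib p q j) := by
  have := F_vajda (p := p) (q := q) n i j
  rw [he.neg_pow] at this
  exact_mod_cast this

lemma L_coprime (hpq : Nat.gcd p q = 1) (n : ℕ) (hn : 0 < n) : Nat.Coprime (pqLucas p q n) q := by
  induction n using Nat.twoStepInduction with
  | zero => omega
  | one => exact hpq
  | more n h0 h1 =>
    rw [pqLucas]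
    rw [Nat.coprime_add_mul_left_left]
    exact Nat.Coprime.mul_left hpq (h1 (by omega))

lemma F_coprime_q (hpq : Nat.gcd p q = 1) (n : ℕ) : Nat.Coprime (pqFib p q (n + 1)) q := by
  induction n with
  | zero => simp [F_one]
  | succ n h =>
    rw [F_two_step, Nat.coprime_add_mul_left_left]
    exact Nat.Coprime.mul_left hpq h

lemma F_coprime_succ (hpq : Nat.gcd p q = 1) (n : ℕ) :
    Nat.Coprime (pqFib p q n) (pqFib p q (n + 1)) := by
  induction n with
  | zero => simp [F_zero, F_one]
  | succ n h =>
    rw [F_two_step, add_comm (p * _), Nat.coprime_add_mul_right_right]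
    exact Nat.Coprime.mul_right (F_coprime_q hpq n) h.symm

lemma F_gcd_add (hpq : Nat.gcd p q = 1) (m n : ℕ) :
    Nat.gcd (pqFib p q m) (pqFib p q (n + m)) = Nat.gcd (pqFib p q m) (pqFib p q n) := by
  cases m with
  | zero => simp
  | succ m =>
    rw [← add_assoc, F_add]
    rw [show pqFib p q (n + 1) * pqFib p q (m + 1) + q * (pqFib p q n * pqFib p q m) =
      (q * pqFib p q m) * pqFib p q n + pqFib p q (n + 1) * pqFib p q (m + 1) by ring,
      Nat.gcd_add_mul_right_right]
    refine Nat.Coprime.gcd_mul_left_cancel_right _ ?_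
    exact Nat.Coprime.mul_right (F_coprime_q hpq m) (F_coprime_succ hpq m).symm |>.symm

lemma F_gcd_add_mul (hpq : Nat.gcd p q = 1) (m n k : ℕ) :
    Nat.gcd (pqFib p q m) (pqFib p q (n + k * m)) = Nat.gcd (pqFib p q m) (pqFib p q n) := by
  induction k with
  | zero => simp
  | succ k h => rw [add_mul, one_mul, ← add_assoc, F_gcd_add hpq, h]

lemma F_gcd (hpq : Nat.gcd p q = 1) (m n : ℕ) :
    pqFib p q (Nat.gcd m n) = Nat.gcd (pqFib p q m) (pqFib p q n) := by
  induction m, n using Nat.gcd.induction with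
  | H0 n => simp [F_zero]
  | H1 m n hm h =>
    rw [Nat.gcd_rec, h]
    conv_rhs => rw [← Nat.mod_add_div n m, mul_comm m]
    rw [F_gcd_add_mul hpq, Nat.gcd_comm]

lemma F_dvd (hpq : Nat.gcd p q = 1) {m n : ℕ} (h : m ∣ n) : pqFib p q m ∣ pqFib p q n := by
  rw [← Nat.gcd_eq_left_iff_dvd, ← F_gcd hpq, Nat.gcd_eq_left h]

lemma F_q_le (k m : ℕ) : q ^ k * pqFib p q m ≤ pqFib p q (m + 2 * k) := by
  induction k with
  | zero => simp
  | succ k ih =>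
    rw [show m + 2 * (k + 1) = m + 2 * k + 2 by ring, F_two_step, pow_succ]
    nlinarith [Nat.zero_le (p * pqFib p q (m + 2 * k + 1)), Nat.mul_le_mul_left q ih]

lemma F_two_le (hp : 0 < p) (hq : 0 < q) (m : ℕ) : 2 * pqFib p q m ≤ pqFib p q (m + 2) := by
  rw [F_two_step]
  nlinarith [F_le_succ (q := q) hp m, Nat.mul_le_mul_right (pqFib p q (m+1)) hp,
    Nat.mul_le_mul_right (pqFib p q m) hq]

lemma F_two_lt (hp : 0 < p) (hq : 0 < q) {m n : ℕ} (hm : 2 ≤ m) (h : m + 2 ≤ n) :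
    2 * pqFib p q m < pqFib p q n := by
  refine lt_of_lt_of_le ?_ (F_mono hp h)
  rw [F_two_step]
  nlinarith [F_lt hp hq hm (Nat.lt_succ_self m), Nat.mul_le_mul_right (pqFib p q (m+1)) hp,
    Nat.mul_le_mul_right (pqFib p q m) hq]

/-- `L_d F_m < F_{m+2d}` for `m ≥ d`, `d` even. -/
lemma L_mul_lt (hp : 0 < p) (hq : 0 < q) {m d : ℕ} (hd : 2 ≤ d) (he : Even d) (hm : d ≤ m) :
    pqLucas p q d * pqFib p q m < pqFib p q (m + 2 * d) := by
  obtain ⟨s, rfl⟩ : ∃ s, m = s + d := ⟨m - d, by omega⟩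
  rw [← L_rec_even s d (by omega) he]
  have h1 := F_q_le (p := p) (q := q) d s
  have h2 := F_two_lt hp hq (m := s + 2 * d) (n := s + d + 2 * d) (by omega) (by omega)
  omega

lemma F_mul_le (m s : ℕ) : pqFib p q (m + 1) * pqFib p q (s + 1) ≤ pqFib p q (m + s + 1) := by
  rw [F_add]; omega

end Fib


open MvPolynomial

/-! ### Critical exponents -/

lemma weight_sum {n : ℕ} (D : Fin n → ℕ) (u : Fin n →₀ ℕ) :
    Finsupp.weight D u = ∑ i, u i * D i := by
  rw [Finsupp.weight_apply, Finsupp.sum_fintype _ _ (by simp)]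
  simp

lemma le_weight' {n : ℕ} (D : Fin n → ℕ) (u : Fin n →₀ ℕ) (i : Fin n) :
    u i * D i ≤ Finsupp.weight D u := by
  rw [weight_sum]
  exact Finset.single_le_sum (f := fun i => u i * D i) (fun _ _ => Nat.zero_le _) (Finset.mem_univ i)

lemma weight_eq_zero' {n : ℕ} (D : Fin n → ℕ) (hD : ∀ i, 0 < D i) (u : Fin n →₀ ℕ)
    (h : Finsupp.weight D u = 0) : u = 0 := by
  ext i
  have := le_weight' D u i
  have := hD i
  simp only [Finsupp.coe_zero, Pi.zero_apply]
  by_contra hne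
  have := Nat.mul_pos (Nat.pos_of_ne_zero hne) (hD i)
  omega

def RedGen {n : ℕ} (D : Fin n → ℕ) (i : Fin n) : Prop :=
  ∃ u : Fin n →₀ ℕ, u i = 0 ∧ Finsupp.weight D u = D i

def SSupp {n : ℕ} (D : Fin n → ℕ) (u : Fin n →₀ ℕ) : Prop := ∀ i, RedGen D i → u i = 0

def IsCrit {n : ℕ} (D : Fin n → ℕ) (i : Fin n) (c : ℕ) : Prop :=
  0 < c ∧ (∃ u, SSupp D u ∧ u i = 0 ∧ Finsupp.weight D u = c * D i) ∧
    ∀ c', 0 < c' → (∃ u, SSupp D u ∧ u i = 0 ∧ Finsupp.weight D u = c' * D i) → c ≤ c'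

lemma SSupp.sum {n : ℕ} {D : Fin n → ℕ} {ι : Type*} (s : Finset ι) (f : ι → (Fin n →₀ ℕ))
    (h : ∀ i ∈ s, SSupp D (f i)) : SSupp D (∑ i ∈ s, f i) := by
  intro j hj
  rw [Finsupp.finsetSum_apply]
  exact Finset.sum_eq_zero fun i hi => h i hi j hj

lemma psi_eq {n : ℕ} (r : Fin n → (Fin n →₀ ℕ)) (u : Fin n →₀ ℕ) :
    Finsupp.linearCombination ℕ r u = ∑ i, u i • r i := by
  rw [Finsupp.linearCombination_apply, Finsupp.sum_fintype _ _ (by simp)]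

lemma exists_r {n : ℕ} (D : Fin n → ℕ) (hD : ∀ i, 0 < D i) (hinj : Function.Injective D) :
    ∃ r : Fin n → (Fin n →₀ ℕ), ∀ l, SSupp D (r l) ∧ Finsupp.weight D (r l) = D l ∧
      (¬ RedGen D l → r l = Finsupp.single l 1) := by
  have : ∀ N, ∀ l, D l = N → ∃ u, SSupp D u ∧ Finsupp.weight D u = D l ∧
      (¬ RedGen D l → u = Finsupp.single l 1) := by
    intro N
    induction N using Nat.strong_induction_on with
    | _ N ih =>
    intro l hl
    by_cases hr : RedGen D l
    · obtain ⟨u, hu, hw⟩ := id hr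
      have : ∀ i, ∃ v, SSupp D v ∧ Finsupp.weight D (u i • v) = u i * D i := by
        intro i
        by_cases h0 : u i = 0
        · exact ⟨0, fun _ _ => rfl, by simp [h0]⟩
        · have h1 : D i ≤ D l := by
            have := le_weight' D u i
            have := Nat.le_mul_of_pos_left (D i) (Nat.pos_of_ne_zero h0)
            omega
          have h2 : D i ≠ D l := fun h => h0 (by rw [hinj h]; exact hu)
          obtain ⟨v, hv, hv2, -⟩ := ih (D i) (by omega) i rfl
          exact ⟨v, hv, by rw [map_nsmul, hv2, smul_eq_mul]⟩
      choose v hv hv2 using this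
      refine ⟨∑ i, u i • v i, SSupp.sum _ _ fun i _ j hj => by simp [hv i j hj], ?_, fun h => (h hr).elim⟩
      rw [map_sum, ← hw, weight_sum]
      exact Finset.sum_congr rfl fun i _ => hv2 i
    · refine ⟨Finsupp.single l 1, ?_, by simp [Finsupp.weight_single], fun _ => rfl⟩
      intro i hi
      rw [Finsupp.single_apply, if_neg]
      rintro rfl
      exact hr hi
  choose r hr using fun l => this (D l) l rfl
  exact ⟨r, hr⟩

lemma weight_psi {n : ℕ} (D : Fin n → ℕ) (r : Fin n → (Fin n →₀ ℕ))
    (hr : ∀ l, Finsupp.weight D (r l) = D l) (u : Fin n →₀ ℕ) :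
    Finsupp.weight D (Finsupp.linearCombination ℕ r u) = Finsupp.weight D u := by
  rw [psi_eq, map_sum, weight_sum]
  exact Finset.sum_congr rfl fun i _ => by rw [map_nsmul, hr, smul_eq_mul]

lemma psi_ssupp {n : ℕ} (D : Fin n → ℕ) (r : Fin n → (Fin n →₀ ℕ))
    (hr : ∀ l, SSupp D (r l)) (u : Fin n →₀ ℕ) :
    SSupp D (Finsupp.linearCombination ℕ r u) := by
  rw [psi_eq]
  exact SSupp.sum _ _ fun i _ j hj => by simp [hr i j hj]

lemma psi_id {n : ℕ} (D : Fin n → ℕ) (r : Fin n → (Fin n →₀ ℕ))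
    (hr : ∀ l, ¬ RedGen D l → r l = Finsupp.single l 1) (u : Fin n →₀ ℕ) (hu : SSupp D u) :
    Finsupp.linearCombination ℕ r u = u := by
  rw [psi_eq]
  conv_rhs => rw [← Finsupp.univ_sum_single u]
  refine Finset.sum_congr rfl fun i _ => ?_
  by_cases h : RedGen D i
  · simp [hu i h]
  · rw [hr i h]; simp

lemma crit_isolated {n : ℕ} (D : Fin n → ℕ) (hD : ∀ i, 0 < D i) {i : Fin n} {c : ℕ}
    (hc : IsCrit D i c) (v : Fin n →₀ ℕ) (hv : SSupp D v) (hw : Finsupp.weight D v = c * D i)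
    (hvi : 0 < v i) : v = Finsupp.single i c := by
  have hle := le_weight' D v i
  rw [hw] at hle
  have hle' : v i ≤ c := Nat.le_of_mul_le_mul_right hle (hD i)
  have hdec : v = Finsupp.single i (v i) + v.erase i := (Finsupp.single_add_erase i v).symm
  have hwe : Finsupp.weight D (v.erase i) = (c - v i) * D i := by
    have := congrArg (Finsupp.weight D) hdec
    rw [map_add, Finsupp.weight_single, hw, smul_eq_mul] at this
    rw [Nat.sub_mul]; omega
  have hce : c = v i := by
    by_contra hne
    have := hc.2.2 (c - v i) (by omega) ⟨v.erase i, fun j hj => by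
      rw [Finsupp.erase_apply]; split_ifs; rfl; exact hv j hj, by simp, hwe⟩
    omega
  rw [← hce, Nat.sub_self, zero_mul] at hwe
  rw [weight_eq_zero' D hD _ hwe, add_zero, ← hce] at hdec
  exact hdec

lemma crit_exists {n : ℕ} (D : Fin n → ℕ) (hD : ∀ i, 0 < D i) (i j : Fin n) (hij : i ≠ j)
    (hj : ¬ RedGen D j) : ∃ c, IsCrit D i c := by
  classical
  have hex : ∃ c, 0 < c ∧ (∃ u, SSupp D u ∧ u i = 0 ∧ Finsupp.weight D u = c * D i) := by
    refine ⟨D j, hD j, Finsupp.single j (D i), ?_, ?_, ?_⟩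
    · intro l hl
      rw [Finsupp.single_apply, if_neg]
      rintro rfl
      exact hj hl
    · rw [Finsupp.single_apply, if_neg hij.symm]
    · rw [Finsupp.weight_single, smul_eq_mul, mul_comm]
  exact ⟨Nat.find hex, (Nat.find_spec hex).1, (Nat.find_spec hex).2,
    fun c' h0 h1 => Nat.find_min' hex ⟨h0, h1⟩⟩

lemma psiSet_closed {n : ℕ} (D : Fin n → ℕ) (hD : ∀ i, 0 < D i) (r : Fin n → (Fin n →₀ ℕ))
    (hr : ∀ l, SSupp D (r l) ∧ Finsupp.weight D (r l) = D l ∧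
      (¬ RedGen D l → r l = Finsupp.single l 1)) {i : Fin n} {c : ℕ} (hc : IsCrit D i c) :
    FibClosed D {u | Finsupp.linearCombination ℕ r u = Finsupp.single i c} := by
  intro u v huv l hul hvl hu
  simp only [Set.mem_ofPred_eq] at hu ⊢
  have hw := weight_psi D r (fun l => (hr l).2.1)
  refine crit_isolated D hD hc _ (psi_ssupp D r (fun l => (hr l).1) v) ?_ ?_
  · rw [hw, ← huv, ← hw, hu, Finsupp.weight_single, smul_eq_mul]
  · -- r l is concentrated at i and nonzero
    have hle : ∀ w : Fin n →₀ ℕ, 0 < w l → ∀ m, r l m ≤ Finsupp.linearCombination ℕ r w m := by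
      intro w hwl m
      rw [psi_eq, Finsupp.finsetSum_apply]
      refine le_trans ?_ (Finset.single_le_sum (f := fun i => (w i • r i) m)
        (fun _ _ => Nat.zero_le _) (Finset.mem_univ l))
      simp only [Finsupp.smul_apply, smul_eq_mul]
      exact Nat.le_mul_of_pos_left _ hwl
    refine lt_of_lt_of_le ?_ (hle v hvl i)
    by_contra h0
    have hz : r l = 0 := by
      ext m
      by_cases hm : m = i
      · subst hm; simp; omega
      · have := hle u hul m
        rw [hu, Finsupp.single_apply, if_neg (Ne.symm hm)] at this
        simpa using this
    have h2 := (hr l).2.1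
    rw [hz, map_zero] at h2
    have := hD l
    omega

lemma single_closed {n : ℕ} (D : Fin n → ℕ) (hD : ∀ i, 0 < D i) (j : Fin n) :
    FibClosed D {Finsupp.single j 1} := by
  intro u v huv l hul hvl hu
  simp only [Set.mem_singleton_iff] at hu ⊢
  subst hu
  have hlj : l = j := by
    by_contra h
    rw [Finsupp.single_apply, if_neg (Ne.symm h)] at hul
    omega
  subst hlj
  have hdec : v = Finsupp.single l (v l) + v.erase l := (Finsupp.single_add_erase l v).symm
  have h1 := congrArg (Finsupp.weight D) hdec
  rw [← huv, map_add, Finsupp.weight_single, Finsupp.weight_single, smul_eq_mul, smul_eq_mul,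
    one_mul] at h1
  have h2 : v l = 1 := by
    have := hD l
    nlinarith
  rw [h2, one_mul] at h1
  rw [weight_eq_zero' D hD (v.erase l) (by omega), h2, add_zero] at hdec
  exact hdec

lemma not_CI_crit (k : Type*) [Field k] {n : ℕ} (D : Fin n → ℕ) (hD : ∀ i, 0 < D i)
    (r : Fin n → (Fin n →₀ ℕ))
    (hr : ∀ l, SSupp D (r l) ∧ Finsupp.weight D (r l) = D l ∧
      (¬ RedGen D l → r l = Finsupp.single l 1))
    (c : Fin n → ℕ) (hc : ∀ i, IsCrit D i (c i)) (z : Fin n) (hz : ¬ RedGen D z)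
    (hdist : ∀ i j, ¬ RedGen D i → ¬ RedGen D j → i ≠ z → j ≠ z → i ≠ j →
      c i * D i ≠ c j * D j)
    (Cz : Set (Fin n →₀ ℕ)) (hCz : FibClosed D Cz) (b : ℕ) (hb : ∀ u ∈ Cz, Finsupp.weight D u = b)
    (wz vz : Fin n →₀ ℕ) (hwz : wz ∈ Cz) (hvz : vz ∉ Cz) (hvzb : Finsupp.weight D vz = b)
    (hcb : ∀ i, ¬ RedGen D i → i ≠ z → c i * D i ≠ b)
    (hred : ∀ i, RedGen D i → (Finsupp.single i 1 ∈ Cz ↔ r i ∈ Cz))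
    (hwz1 : ∀ i, RedGen D i → wz ≠ Finsupp.single i 1)
    (hvz1 : ∀ i, RedGen D i → vz ≠ Finsupp.single i 1) : ¬ IsCI k D := by
  classical
  have hwzb := hb wz hwz
  have hW := weight_psi D r (fun l => (hr l).2.1)
  choose v0 hv0S hv0i hv0w using fun i => (hc i).2.1
  let psi := Finsupp.linearCombination ℕ r
  have hpid : ∀ u, SSupp D u → psi u = u := psi_id D r (fun l => (hr l).2.2)
  have hsS : ∀ i, ¬ RedGen D i → ∀ m, SSupp D (Finsupp.single i m) := by
    intro i hi m l hl
    rw [Finsupp.single_apply, if_neg]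
    rintro rfl
    exact hi hl
  have hws : ∀ i m, Finsupp.weight D (Finsupp.single i m) = m * D i := by
    intro i m; rw [Finsupp.weight_single, smul_eq_mul]
  refine not_CI k (by have := z.pos; omega) D
    (fun i => if RedGen D i then {Finsupp.single i 1} else if i = z then Cz else
      {u | psi u = Finsupp.single i (c i)}) ?_
    (fun i => if RedGen D i then Finsupp.single i 1 else if i = z then wz else
      Finsupp.single i (c i))
    (fun i => if RedGen D i then r i else if i = z then vz else v0 i) ?_ ?_ ?_ ?_
  · intro i
    split_ifs with h1 h2
    · exact single_closed D hD i
    · exact hCz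
    · exact psiSet_closed D hD r hr (hc i)
  · intro i
    split_ifs with h1 h2
    · rw [(hr i).2.1, hws, one_mul]
    · rw [hwzb, hvzb]
    · rw [hv0w, hws]
  · intro i
    split_ifs with h1 h2
    · rfl
    · exact hwz
    · exact hpid _ (hsS i h1 _)
  · intro i
    split_ifs with h1 h2
    · simp only [Set.mem_singleton_iff]
      intro h
      have := (hr i).1 i h1
      rw [h] at this
      simp at this
    · exact hvz
    · simp only [Set.mem_ofPred_eq]
      rw [hpid _ (hv0S i)]
      intro h
      have h3 := hv0i i
      rw [h, Finsupp.single_eq_same] at h3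
      have := (hc i).1
      omega
  · intro i j hij
    have hrne : ∀ u, SSupp D u → ∀ j, RedGen D j → u ≠ Finsupp.single j 1 := by
      intro u hu j hj h
      have := hu j hj
      rw [h] at this
      simp at this
    by_cases hi : RedGen D i
    · simp only [if_pos hi]
      by_cases hj : RedGen D j
      · simp only [if_pos hj, Set.mem_singleton_iff]
        refine iff_of_false ?_ (hrne _ (hr i).1 j hj)
        intro h
        exact hij ((Finsupp.single_left_inj one_ne_zero).1 h)
      · simp only [if_neg hj]
        by_cases hjz : j = z
        · simp only [if_pos hjz]
          exact hred i hi
        · simp only [if_neg hjz, Set.mem_ofPred_eq]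
          rw [hpid _ (hr i).1]
          simp [psi]
    · simp only [if_neg hi]
      by_cases hiz : i = z
      · simp only [if_pos hiz]
        have hjz : j ≠ z := fun h => hij (hiz.trans h.symm)
        by_cases hj : RedGen D j
        · simp only [if_pos hj, Set.mem_singleton_iff]
          exact iff_of_false (hwz1 j hj) (hvz1 j hj)
        · simp only [if_neg hj, if_neg hjz, Set.mem_ofPred_eq]
          refine iff_of_false ?_ ?_
          · intro h
            have := hW wz
            change Finsupp.weight D (psi wz) = _ at this
            rw [h, hws, hwzb] at this
            exact hcb j hj hjz this
          · intro h
            have := hW vz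
            change Finsupp.weight D (psi vz) = _ at this
            rw [h, hws, hvzb] at this
            exact hcb j hj hjz this
      · simp only [if_neg hiz]
        by_cases hj : RedGen D j
        · simp only [if_pos hj, Set.mem_singleton_iff]
          exact iff_of_false (hrne _ (hsS i hi _) j hj) (hrne _ (hv0S i) j hj)
        · simp only [if_neg hj]
          by_cases hjz : j = z
          · simp only [if_pos hjz]
            refine iff_of_false ?_ ?_
            · intro h
              have := hb _ h
              rw [hws] at this
              exact hcb i hi hiz this
            · intro h
              have := hb _ h
              rw [hv0w] at this
              exact hcb i hi hiz this
          · simp only [if_neg hjz, Set.mem_ofPred_eq]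
            rw [hpid _ (hv0S i), hpid _ (hsS i hi _)]
            have := hdist i j hi hj hiz hjz hij
            refine iff_of_false ?_ ?_
            · intro h
              have h2 := congrArg (Finsupp.weight D) h
              rw [hws, hws] at h2
              exact this h2
            · intro h
              have h2 := congrArg (Finsupp.weight D) h
              rw [hws, hv0w] at h2
              exact this h2

/-- Mode 1: all critical degrees distinct. -/
lemma not_CI_mode1 (k : Type*) [Field k] {n : ℕ} (D : Fin n → ℕ) (hD : ∀ i, 0 < D i)
    (r : Fin n → (Fin n →₀ ℕ))
    (hr : ∀ l, SSupp D (r l) ∧ Finsupp.weight D (r l) = D l ∧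
      (¬ RedGen D l → r l = Finsupp.single l 1))
    (c : Fin n → ℕ) (hc : ∀ i, IsCrit D i (c i)) (z : Fin n) (hz : ¬ RedGen D z)
    (hdist : ∀ i j, ¬ RedGen D i → ¬ RedGen D j → i ≠ j → c i * D i ≠ c j * D j) :
    ¬ IsCI k D := by
  obtain ⟨hc0, ⟨v, hvS, hvz, hvw⟩, -⟩ := hc z
  have hpid : ∀ u, SSupp D u → Finsupp.linearCombination ℕ r u = u :=
    psi_id D r (fun l => (hr l).2.2)
  have hsS : ∀ m, SSupp D (Finsupp.single z m) := by
    intro m l hl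
    rw [Finsupp.single_apply, if_neg]
    rintro rfl
    exact hz hl
  refine not_CI_crit k D hD r hr c hc z hz (fun i j hi hj _ _ h => hdist i j hi hj h)
    {u | Finsupp.linearCombination ℕ r u = Finsupp.single z (c z)}
    (psiSet_closed D hD r hr (hc z)) (c z * D z) ?_ (Finsupp.single z (c z)) v
    (hpid _ (hsS _)) ?_ hvw (fun i hi hiz => hdist i z hi hz hiz) ?_ ?_ ?_
  · intro u hu
    have := weight_psi D r (fun l => (hr l).2.1) u
    rw [hu, Finsupp.weight_single] at this
    rw [← this, smul_eq_mul]
  · simp only [Set.mem_ofPred_eq]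
    rw [hpid _ hvS]
    intro h
    rw [h, Finsupp.single_eq_same] at hvz
    omega
  · intro i hi
    simp only [Set.mem_ofPred_eq]
    rw [hpid _ (hr i).1]
    simp
  · intro i hi h
    have := hsS (c z) i hi
    rw [h] at this
    simp at this
  · intro i hi h
    have := hvS i hi
    rw [h] at this
    simp at this

/-- Mode 2: critical degrees distinct away from `z`, plus an extra two-element fibre. -/
lemma not_CI_mode2 (k : Type*) [Field k] {n : ℕ} (D : Fin n → ℕ) (hD : ∀ i, 0 < D i)
    (r : Fin n → (Fin n →₀ ℕ))
    (hr : ∀ l, SSupp D (r l) ∧ Finsupp.weight D (r l) = D l ∧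
      (¬ RedGen D l → r l = Finsupp.single l 1))
    (c : Fin n → ℕ) (hc : ∀ i, IsCrit D i (c i)) (z : Fin n) (hz : ¬ RedGen D z)
    (hdist : ∀ i j, ¬ RedGen D i → ¬ RedGen D j → i ≠ z → j ≠ z → i ≠ j →
      c i * D i ≠ c j * D j)
    (w v : Fin n →₀ ℕ) (hwv : Finsupp.weight D w = Finsupp.weight D v)
    (hdisj : ∀ l, w l = 0 ∨ v l = 0) (hw : ∀ i m, w ≠ Finsupp.single i m)
    (hv : ∀ i m, v ≠ Finsupp.single i m)
    (hfib : ∀ u, Finsupp.weight D u = Finsupp.weight D w → u = w ∨ u = v) :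
    ¬ IsCI k D := by
  have hne : v ≠ w := by
    rintro rfl
    apply hw z 0
    ext l
    have := hdisj l
    simp; omega
  have hpure : ∀ i m, m * D i ≠ Finsupp.weight D w := by
    intro i m h
    rcases hfib (Finsupp.single i m) (by rw [Finsupp.weight_single, smul_eq_mul, h]) with h | h
    · exact hw i m h.symm
    · exact hv i m h.symm
  refine not_CI_crit k D hD r hr c hc z hz hdist {w} ?_ (Finsupp.weight D w) ?_ w v rfl hne hwv.symm
    (fun i _ _ => hpure i _) ?_ (fun i _ => hw i 1) (fun i _ => hv i 1)
  · intro u u' huu' l hul hul' hu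
    simp only [Set.mem_singleton_iff] at hu ⊢
    subst hu
    rcases hfib u' huu'.symm with h | h
    · exact h
    · subst h
      have := hdisj l
      omega
  · rintro u rfl; rfl
  · intro i hi
    simp only [Set.mem_singleton_iff]
    refine iff_of_false (fun h => hw i 1 h.symm) fun h => ?_
    have := (hr i).2.1
    rw [h] at this
    exact hpure i 1 (by rw [one_mul, this])


open MvPolynomial

/-! ### Sufficiency -/

lemma two_gen_aux {M : Type*} [CommMonoid M] (x y : M) (a b : ℕ) (ha : 0 < a) (hb : 0 < b)
    (hxy : x ^ (b / Nat.gcd a b) = y ^ (a / Nat.gcd a b)) (s t s' t' : ℕ)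
    (h : s * a + t * b = s' * a + t' * b) : x ^ s * y ^ t = x ^ s' * y ^ t' := by
  wlog hss : s' ≤ s generalizing s t s' t'
  · exact (this s' t' s t h.symm (by omega)).symm
  obtain ⟨e, rfl⟩ : ∃ e, s = s' + e := ⟨s - s', by omega⟩
  have htt : t ≤ t' := by
    by_contra hlt
    push Not at hlt
    have h1 := Nat.mul_lt_mul_of_pos_right hlt hb
    have h2 : s' * a ≤ (s' + e) * a := Nat.mul_le_mul_right _ (by omega)
    omega
  obtain ⟨f, rfl⟩ : ∃ f, t' = t + f := ⟨t' - t, by omega⟩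
  have h3 : e * a = f * b := by nlinarith
  have hg : 0 < Nat.gcd a b := Nat.gcd_pos_of_pos_left _ ha
  have hca : a = a / Nat.gcd a b * Nat.gcd a b := (Nat.div_mul_cancel (Nat.gcd_dvd_left a b)).symm
  have hcb : b = b / Nat.gcd a b * Nat.gcd a b := (Nat.div_mul_cancel (Nat.gcd_dvd_right a b)).symm
  have hcop : Nat.Coprime (a / Nat.gcd a b) (b / Nat.gcd a b) := Nat.coprime_div_gcd_div_gcd hg
  generalize a / Nat.gcd a b = a' at *
  generalize b / Nat.gcd a b = b' at *
  generalize Nat.gcd a b = g at *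
  subst hca
  subst hcb
  have h4 : e * a' = f * b' := by
    apply Nat.eq_of_mul_eq_mul_right hg
    rw [mul_assoc, h3, mul_assoc]
  obtain ⟨m, rfl⟩ : b' ∣ e := hcop.symm.dvd_of_dvd_mul_right (by rw [h4]; exact Dvd.intro_left f rfl)
  have hb' : 0 < b' := Nat.pos_of_mul_pos_right hb
  have h5 : f = a' * m := by
    apply Nat.eq_of_mul_eq_mul_right hb'
    rw [← h4]; ring
  subst h5
  rw [pow_add, pow_add, pow_mul, pow_mul, hxy]
  rw [mul_assoc, mul_comm _ (y ^ t)]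

lemma mk_monomial {k : Type*} [Field k] {n : ℕ} (J : Ideal (MvPolynomial (Fin n) k))
    (u : Fin n →₀ ℕ) : Ideal.Quotient.mk J (monomial u 1) =
      ∏ i, (Ideal.Quotient.mk J (X i)) ^ u i := by
  rw [monomial_eq, map_mul, map_one, map_one, one_mul, Finsupp.prod_fintype _ _ (by simp), map_prod]
  simp

lemma suf_two (k : Type*) [Field k] {n : ℕ} (hn : 2 ≤ n) (D : Fin n → ℕ)
    (h0 : 0 < D ⟨0, by omega⟩) (h1 : 0 < D ⟨1, by omega⟩)
    (h : ∀ i : Fin n, 2 ≤ (i : ℕ) → ∃ s t, D i = s * D ⟨0, by omega⟩ + t * D ⟨1, by omega⟩) :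
    IsCI k D := by
  have h' : ∀ i : Fin n, ∃ s t, D i = s * D ⟨0, by omega⟩ + t * D ⟨1, by omega⟩ ∧
      ((i : ℕ) = 0 → s = 1 ∧ t = 0) ∧ ((i : ℕ) = 1 → s = 0 ∧ t = 1) := by
    intro i
    by_cases hi0 : (i : ℕ) = 0
    · exact ⟨1, 0, by rw [show i = ⟨0, by omega⟩ from Fin.ext hi0]; simp, fun _ => ⟨rfl, rfl⟩, fun h => by omega⟩
    by_cases hi1 : (i : ℕ) = 1
    · exact ⟨0, 1, by rw [show i = ⟨1, by omega⟩ from Fin.ext hi1]; simp, fun h => by omega, fun h => ⟨rfl, rfl⟩⟩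
    obtain ⟨s, t, hst⟩ := h i (by omega)
    exact ⟨s, t, hst, fun h => by omega, fun h => by omega⟩
  choose A B hAB hA0 hA1 using h'
  set i0 : Fin n := ⟨0, by omega⟩ with hi0
  set i1 : Fin n := ⟨1, by omega⟩ with hi1
  let g : Fin (n - 1) → MvPolynomial (Fin n) k := fun j =>
    if (j : ℕ) = 0 then X i0 ^ (D i1 / Nat.gcd (D i0) (D i1)) - X i1 ^ (D i0 / Nat.gcd (D i0) (D i1))
    else X ⟨j + 1, by omega⟩ - X i0 ^ A ⟨j + 1, by omega⟩ * X i1 ^ B ⟨j + 1, by omega⟩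
  refine suf_CI k D g ?_ ?_
  · intro j
    rw [mem_toric]
    simp only [g]
    split_ifs with hj
    · rw [map_sub, map_pow, map_pow, aeval_X, aeval_X, ← pow_mul, ← pow_mul, sub_eq_zero]
      congr 1
      rw [← Nat.mul_div_assoc _ (Nat.gcd_dvd_right _ _), ← Nat.mul_div_assoc _ (Nat.gcd_dvd_left _ _),
        mul_comm]
    · rw [map_sub, map_mul, map_pow, map_pow, aeval_X, aeval_X, aeval_X, ← pow_mul, ← pow_mul,
        ← pow_add, sub_eq_zero]
      congr 1
      rw [hAB ⟨j + 1, by omega⟩]; ring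
  · intro u v huv
    rw [← Ideal.Quotient.eq, mk_monomial, mk_monomial]
    set y : Fin n → _ := fun i => Ideal.Quotient.mk (Ideal.span (Set.range g)) (X i) with hy
    have hy01 : y i0 ^ (D i1 / Nat.gcd (D i0) (D i1)) = y i1 ^ (D i0 / Nat.gcd (D i0) (D i1)) := by
      have : g ⟨0, by omega⟩ ∈ Ideal.span (Set.range g) := Ideal.subset_span ⟨_, rfl⟩
      simp only [g, if_true] at this
      rw [← Ideal.Quotient.eq] at this
      simpa [hy] using this
    have hyi : ∀ i, y i = y i0 ^ A i * y i1 ^ B i := by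
      intro i
      by_cases hi0' : (i : ℕ) = 0
      · rw [(hA0 i hi0').1, (hA0 i hi0').2, show i = i0 from Fin.ext hi0']; simp
      by_cases hi1' : (i : ℕ) = 1
      · rw [(hA1 i hi1').1, (hA1 i hi1').2, show i = i1 from Fin.ext hi1']; simp
      have : g ⟨i - 1, by omega⟩ ∈ Ideal.span (Set.range g) := Ideal.subset_span ⟨_, rfl⟩
      have hne : ¬ ((i : ℕ) - 1 = 0) := by omega
      have hii : (⟨(i : ℕ) - 1 + 1, by omega⟩ : Fin n) = i := Fin.ext (by simp; omega)
      simp only [g, if_neg hne, hii] at this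
      rw [← Ideal.Quotient.eq] at this
      simpa [hy] using this
    have hprod : ∀ w : Fin n →₀ ℕ, ∏ i, y i ^ w i =
        y i0 ^ (∑ i, A i * w i) * y i1 ^ (∑ i, B i * w i) := by
      intro w
      rw [← Finset.prod_pow_eq_pow_sum, ← Finset.prod_pow_eq_pow_sum, ← Finset.prod_mul_distrib]
      refine Finset.prod_congr rfl fun i _ => ?_
      rw [hyi i, mul_pow, ← pow_mul, ← pow_mul]
    change ∏ i, y i ^ u i = ∏ i, y i ^ v i
    rw [hprod, hprod]
    refine two_gen_aux _ _ (D i0) (D i1) h0 h1 hy01 _ _ _ _ ?_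
    have hwt : ∀ w : Fin n →₀ ℕ, (∑ i, A i * w i) * D i0 + (∑ i, B i * w i) * D i1 =
        Finsupp.weight D w := by
      intro w
      rw [weight_sum, Finset.sum_mul, Finset.sum_mul, ← Finset.sum_add_distrib]
      refine Finset.sum_congr rfl fun i _ => ?_
      rw [hAB i]; ring
    rw [hwt, hwt, huv]

lemma suf_three (k : Type*) [Field k] (D : Fin 3 → ℕ) (h0 : 0 < D 0) (h2 : 0 < D 2) (L c G : ℕ)
    (hL : L * D 1 = D 2 + c * D 0) (hG0 : G ∣ D 0) (hG2 : G ∣ D 2)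
    (hG : ∀ m, G ∣ m * D 1 → L ∣ m) : IsCI k D := by
  let g : Fin (3 - 1) → MvPolynomial (Fin 3) k := fun j =>
    if (j : ℕ) = 0 then X 0 ^ (D 2 / Nat.gcd (D 0) (D 2)) - X 2 ^ (D 0 / Nat.gcd (D 0) (D 2))
    else X 1 ^ L - X 2 * X 0 ^ c
  refine suf_CI k D g ?_ ?_
  · intro j
    rw [mem_toric]
    simp only [g]
    split_ifs with hj
    · rw [map_sub, map_pow, map_pow, aeval_X, aeval_X, ← pow_mul, ← pow_mul, sub_eq_zero]
      congr 1
      rw [← Nat.mul_div_assoc _ (Nat.gcd_dvd_right _ _), ← Nat.mul_div_assoc _ (Nat.gcd_dvd_left _ _),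
        mul_comm]
    · rw [map_sub, map_mul, map_pow, map_pow, aeval_X, aeval_X, aeval_X, ← pow_mul, ← pow_mul,
        ← pow_add, sub_eq_zero]
      congr 1
      linarith
  · intro u v huv
    rw [← Ideal.Quotient.eq, mk_monomial, mk_monomial]
    set y : Fin 3 → _ := fun i => Ideal.Quotient.mk (Ideal.span (Set.range g)) (X i) with hy
    have hy02 : y 0 ^ (D 2 / Nat.gcd (D 0) (D 2)) = y 2 ^ (D 0 / Nat.gcd (D 0) (D 2)) := by
      have : g ⟨0, by omega⟩ ∈ Ideal.span (Set.range g) := Ideal.subset_span ⟨_, rfl⟩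
      simp only [g, if_true] at this
      rw [← Ideal.Quotient.eq] at this
      simpa [hy] using this
    have hy1 : y 1 ^ L = y 2 * y 0 ^ c := by
      have : g ⟨1, by omega⟩ ∈ Ideal.span (Set.range g) := Ideal.subset_span ⟨_, rfl⟩
      simp only [g, if_neg one_ne_zero] at this
      rw [← Ideal.Quotient.eq] at this
      simpa [hy] using this
    change ∏ i, y i ^ u i = ∏ i, y i ^ v i
    rw [weight_sum, weight_sum] at huv
    rw [Fin.prod_univ_three, Fin.prod_univ_three]
    rw [Fin.sum_univ_three, Fin.sum_univ_three] at huv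
    generalize u 0 = u0 at *
    generalize u 1 = u1 at *
    generalize u 2 = u2 at *
    generalize v 0 = v0 at *
    generalize v 1 = v1 at *
    generalize v 2 = v2 at *
    wlog hss : v1 ≤ u1 generalizing u0 u1 u2 v0 v1 v2
    · exact (this v0 v1 v2 u0 u1 u2 huv.symm (by omega)).symm
    obtain ⟨e, rfl⟩ : ∃ e, u1 = v1 + e := ⟨u1 - v1, by omega⟩
    have hdv : G ∣ e * D 1 := by
      have e1 : u0 * D 0 + u2 * D 2 + e * D 1 = v0 * D 0 + v2 * D 2 := by nlinarith
      have e2 : G ∣ u0 * D 0 + u2 * D 2 := dvd_add (hG0.mul_left _) (hG2.mul_left _)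
      have e3 : G ∣ v0 * D 0 + v2 * D 2 := dvd_add (hG0.mul_left _) (hG2.mul_left _)
      rw [← e1] at e3
      exact (Nat.dvd_add_right e2).1 e3
    obtain ⟨m, rfl⟩ := hG e hdv
    have key := two_gen_aux (y 0) (y 2) (D 0) (D 2) h0 h2 hy02 (u0 + c * m) (u2 + m) v0 v2
      (by
        have : L * m * D 1 = m * D 2 + c * m * D 0 := by
          calc L * m * D 1 = m * (L * D 1) := by ring
            _ = _ := by rw [hL]; ring
        nlinarith)
    calc y 0 ^ u0 * y 1 ^ (v1 + L * m) * y 2 ^ u2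
        = y 1 ^ v1 * (y 0 ^ (u0 + c * m) * y 2 ^ (u2 + m)) := by
          rw [pow_add, pow_mul, hy1, pow_add, pow_add, mul_pow, pow_mul]; ring
      _ = _ := by rw [key]; ring

lemma frob {A B X : ℕ} (hA : 0 < A) (hB : 0 < B) (hg : Nat.gcd A B ∣ X)
    (hX : A * B ≤ X * Nat.gcd A B) : ∃ s t, X = s * A + t * B := by
  have hgp : 0 < Nat.gcd A B := Nat.gcd_pos_of_pos_left _ hA
  have hca := (Nat.div_mul_cancel (Nat.gcd_dvd_left A B)).symm
  have hcb := (Nat.div_mul_cancel (Nat.gcd_dvd_right A B)).symm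
  have hcop : Nat.Coprime (A / Nat.gcd A B) (B / Nat.gcd A B) := Nat.coprime_div_gcd_div_gcd hgp
  obtain ⟨x, hx⟩ := hg
  generalize A / Nat.gcd A B = a at *
  generalize B / Nat.gcd A B = b at *
  generalize Nat.gcd A B = g at *
  subst hca hcb hx
  have ha : 0 < a := Nat.pos_of_mul_pos_right hA
  have hx : a * b ≤ x := by
    have : (a * b) * (g * g) ≤ x * (g * g) := by nlinarith
    exact Nat.le_of_mul_le_mul_right this (by positivity)
  -- t ≡ x / b mod a
  obtain ⟨t, ht, htm⟩ : ∃ t, t < a ∧ t * b ≡ x [MOD a] := by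
    obtain ⟨i, hi⟩ : ∃ i, b * i ≡ 1 [MOD a] := by
      rcases Nat.lt_or_ge 1 a with h1 | h1
      · obtain ⟨i, hi⟩ := Nat.exists_mul_mod_eq_one_of_coprime hcop.symm h1
        exact ⟨i, by rw [Nat.ModEq, hi.2, Nat.mod_eq_of_lt h1]⟩
      · have : a = 1 := by omega
        exact ⟨0, by rw [this]; exact Nat.modEq_one⟩
    refine ⟨(i * x) % a, Nat.mod_lt _ ha, ?_⟩
    calc (i * x) % a * b ≡ i * x * b [MOD a] := (Nat.mod_modEq _ _).mul_right _
      _ = b * i * x := by ring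
      _ ≡ 1 * x [MOD a] := hi.mul_right _
      _ = x := one_mul x
  have hle : t * b ≤ x := le_trans (Nat.mul_le_mul_right _ ht.le) hx
  obtain ⟨s, hs⟩ := (Nat.modEq_iff_dvd' hle).1 htm
  refine ⟨s, t, ?_⟩
  have : x = a * s + t * b := by omega
  rw [this]; ring



section Suff
variable {p q : ℕ}

lemma gcd_Fa (hpq : Nat.gcd p q = 1) (h a m : ℕ) :
    Nat.gcd (pqFib p q a) (pqFib p q (h * a + m)) = pqFib p q (Nat.gcd a m) := by
  rw [← F_gcd hpq, add_comm, Nat.gcd_add_mul_right_right]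

lemma suf_odd (hpq : Nat.gcd p q = 1) (h a d : ℕ) (hd : Odd d) (i : ℕ) :
    (∃ s t, pqFib p q (h * a + i * d) = s * pqFib p q a + t * pqFib p q (h * a + 1 * d)) ∧
    (∃ s t, pqFib p q (h * a + (i + 1) * d) = s * pqFib p q a + t * pqFib p q (h * a + 1 * d)) := by
  induction i with
  | zero =>
    refine ⟨?_, 0, 1, by simp⟩
    obtain ⟨s, hs⟩ := F_dvd (p := p) (q := q) hpq (Dvd.intro_left h rfl : a ∣ h * a)
    exact ⟨s, 0, by simp [hs, mul_comm]⟩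
  | succ i ih =>
    refine ⟨ih.2, ?_⟩
    obtain ⟨⟨s, t, h1⟩, s', t', h2⟩ := ih
    have := L_rec_odd (p := p) (q := q) (h * a + i * d) d hd
    rw [show h * a + (i + 1 + 1) * d = h * a + i * d + 2 * d by ring, this,
      show h * a + i * d + d = h * a + (i + 1) * d by ring, h1, h2]
    exact ⟨pqLucas p q d * s' + q ^ d * s, pqLucas p q d * t' + q ^ d * t, by ring⟩

lemma suf_even (hp : 0 < p) (hq : 0 < q) (hpq : Nat.gcd p q = 1) (h a d : ℕ) (ha : 0 < a)
    (hd : 0 < d) (he : Even d)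
    (hL : pqFib p q a ≤ pqLucas p q d * pqFib p q (Nat.gcd a d)) (i : ℕ) (hi : 2 ≤ i) :
    ∃ s t, pqFib p q (h * a + i * d) = s * pqFib p q a + t * pqFib p q (h * a + 1 * d) := by
  have hd2 : 2 ≤ d := by obtain ⟨e, rfl⟩ := he; omega
  have hgp : 0 < Nat.gcd a d := Nat.gcd_pos_of_pos_left _ ha
  have hFa := F_pos (q := q) hp ha
  have hFg := F_pos (q := q) hp hgp
  have hG1 : 0 < pqFib p q (h * a + 1 * d) := F_pos hp (by omega)
  rcases Nat.eq_or_lt_of_le hi with rfl | hi3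
  · obtain ⟨M, hM⟩ := F_dvd (p := p) (q := q) hpq (Nat.gcd_dvd_left a d)
    have hML : M ≤ pqLucas p q d := by
      rw [hM, mul_comm] at hL
      exact Nat.le_of_mul_le_mul_right hL hFg
    have hMp : 0 < M := by
      rcases Nat.eq_zero_or_pos M with rfl | h
      · simp at hM; omega
      · exact h
    obtain ⟨k1, hk1⟩ : pqFib p q (Nat.gcd a d) ∣ pqFib p q (h * a + 1 * d) :=
      F_dvd hpq (dvd_add ((Nat.gcd_dvd_left a d).mul_left _) (by simpa using Nat.gcd_dvd_right a d))
    obtain ⟨k0, hk0⟩ := F_dvd (p := p) (q := q) hpq (Dvd.intro_left h rfl : a ∣ h * a)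
    have hrec := L_rec_even (p := p) (q := q) (h * a) d hd he
    have hq' := F_q_le (p := p) (q := q) d (h * a)
    rw [show h * a + d = h * a + 1 * d by ring] at hrec
    have hj := Nat.div_add_mod (pqLucas p q d) M
    have hs := Nat.mod_lt (pqLucas p q d) hMp
    have hj1 : 1 ≤ pqLucas p q d / M := (Nat.one_le_div_iff hMp).2 hML
    generalize pqLucas p q d / M = j at *
    generalize pqLucas p q d % M = s at *
    generalize pqLucas p q d = L at *
    generalize q ^ d = Q at *
    have h1 : L ≤ 2 * (M * j) := by nlinarith
    have h2 : M * j * pqFib p q (h * a + 1 * d) = j * k1 * pqFib p q a := by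
      rw [hk1, hM]; ring
    have h3 : Q * (k0 * pqFib p q a) ≤ j * k1 * pqFib p q a := by
      rw [← h2]
      have := Nat.mul_le_mul_right (pqFib p q (h * a + 1 * d)) h1
      have h4 : Q * pqFib p q (h * a) = Q * (k0 * pqFib p q a) := by rw [hk0]; ring
      rw [h4] at hq' hrec
      nlinarith
    refine ⟨j * k1 - Q * k0, s, ?_⟩
    have h5 : Q * k0 ≤ j * k1 := by
      rw [← mul_assoc] at h3
      exact Nat.le_of_mul_le_mul_right h3 hFa
    obtain ⟨e, he⟩ := Nat.exists_eq_add_of_le h5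
    rw [he, Nat.add_sub_cancel_left]
    rw [he] at h2
    rw [← hj, hk0] at hrec
    nlinarith
  · refine frob hFa hG1 ?_ ?_
    · rw [gcd_Fa hpq, one_mul]
      exact F_dvd hpq (dvd_add ((Nat.gcd_dvd_left a d).mul_left _) ((Nat.gcd_dvd_right a d).mul_left _))
    · rw [gcd_Fa hpq, one_mul]
      have h1 := L_mul_lt hp hq hd2 he (show d ≤ h * a + d by omega)
      have h2 : pqFib p q (h * a + d + 2 * d) ≤ pqFib p q (h * a + i * d) :=
        F_mono hp (by nlinarith)
      calc pqFib p q a * pqFib p q (h * a + d)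
          ≤ (pqLucas p q d * pqFib p q (Nat.gcd a d)) * pqFib p q (h * a + d) :=
            Nat.mul_le_mul_right _ hL
        _ = (pqLucas p q d * pqFib p q (h * a + d)) * pqFib p q (Nat.gcd a d) := by ring
        _ ≤ _ := Nat.mul_le_mul_right _ (by omega)

lemma key_ge (hp : 0 < p) (a d : ℕ) (ha : 0 < a) (hd : 0 < d)
    (hc : a ≤ d ∨ a = 2 * d ∨ (Nat.gcd a d = a - d ∧ Odd a)) (he : Even d) :
    pqFib p q a ≤ pqLucas p q d * pqFib p q (Nat.gcd a d) := by
  have hgp : 0 < Nat.gcd a d := Nat.gcd_pos_of_pos_left _ ha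
  rcases hc with h | rfl | ⟨h1, h2⟩
  · have hFg := F_pos (q := q) hp hgp
    obtain ⟨e, rfl⟩ : ∃ e, d = e + 1 := ⟨d - 1, by omega⟩
    have h1 := L_eq (p := p) (q := q) e
    have h2 : pqFib p q a ≤ pqFib p q (e + 2) := F_mono hp (by omega)
    nlinarith
  · rw [show Nat.gcd (2 * d) d = d by simp]
    have := L_mul_even (p := p) (q := q) 0 d (by omega) he
    simp only [F_zero, mul_zero, add_zero] at this
    rw [this, two_mul]
  · have hlt : d < a := by omega
    have hgo : Odd (Nat.gcd a d) := by rw [h1]; exact Nat.Odd.sub_even hlt.le h2 he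
    obtain ⟨s, hs⟩ : ∃ s, d = Nat.gcd a d + s :=
      ⟨d - Nat.gcd a d, by have := Nat.le_of_dvd hd (Nat.gcd_dvd_right a d); omega⟩
    have := L_mul_odd (p := p) (q := q) s _ hgo
    rw [← hs] at this
    rw [this, show d + Nat.gcd a d = a by omega]
    omega

lemma suff (k : Type*) [Field k] (hp : 0 < p) (hq : 0 < q)
    (hpq : Nat.gcd p q = 1) (h a d : ℕ) (hh : 0 < h) (ha : 0 < a) (hd : 0 < d)
    (n : ℕ) (hn : 3 ≤ n)
    (hc : Odd d ∨ a ≤ d ∨ a = 2 * d ∨ (Nat.gcd a d = a - d ∧ Odd a) ∨ (n = 3 ∧ 2 * d ∣ a)) :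
    IsCI k (fun i : Fin n =>
        if (i : ℕ) = 0 then pqFib p q a else pqFib p q (h * a + (i : ℕ) * d)) := by
  have hFa := F_pos (q := q) hp ha
  have hG1 : 0 < pqFib p q (h * a + 1 * d) := F_pos hp (by omega)
  by_cases ho : Odd d
  · refine suf_two k (by omega) _ ?_ ?_ ?_
    · simpa using hFa
    · simpa using hG1
    · intro i hi
      obtain ⟨s, t, hst⟩ := (suf_odd hpq h a d ho i).1
      refine ⟨s, t, ?_⟩
      simp only [if_neg (show ¬ (i : ℕ) = 0 by omega), if_true, if_neg one_ne_zero]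
      exact hst
  have he := Nat.not_odd_iff_even.1 ho
  by_cases hc' : a ≤ d ∨ a = 2 * d ∨ (Nat.gcd a d = a - d ∧ Odd a)
  · refine suf_two k (by omega) _ ?_ ?_ ?_
    · simpa using hFa
    · simpa using hG1
    · intro i hi
      obtain ⟨s, t, hst⟩ := suf_even hp hq hpq h a d ha hd he (key_ge hp a d ha hd hc' he) i hi
      refine ⟨s, t, ?_⟩
      simp only [if_neg (show ¬ (i : ℕ) = 0 by omega), if_true, if_neg one_ne_zero]
      exact hst
  obtain ⟨rfl, hda⟩ : n = 3 ∧ 2 * d ∣ a := by tauto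
  obtain ⟨k0, hk0⟩ := F_dvd (p := p) (q := q) hpq (Dvd.intro_left h rfl : a ∣ h * a)
  have hFd := F_pos (q := q) hp hd
  have hx : 2 * d ∣ h * a := hda.mul_left _
  have hL2 : pqLucas p q d * pqFib p q d = pqFib p q (2 * d) := by
    have := L_mul_even (p := p) (q := q) 0 d (by omega) he
    simp only [F_zero, mul_zero, add_zero] at this
    rw [this, two_mul]
  have hrec := L_rec_even (p := p) (q := q) (h * a) d hd he
  refine suf_three k _ ?_ ?_ (pqLucas p q d) (q ^ d * k0) (pqFib p q (2 * d)) ?_ ?_ ?_ ?_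
  · simpa using hFa
  · have : 0 < pqFib p q (h * a + 2 * d) := F_pos hp (by omega)
    simpa using this
  · simp
    rw [← hrec, hk0]; ring
  · simpa using F_dvd hpq hda
  · simpa using F_dvd (p := p) (q := q) hpq (dvd_add hx (dvd_refl (2 * d)))
  · intro m hm
    simp only [Fin.val_one, one_ne_zero, if_false, one_mul] at hm
    have hg : Nat.gcd (pqFib p q (2 * d)) (pqFib p q (h * a + d)) = pqFib p q d := by
      obtain ⟨y, hy⟩ := hx
      rw [hy, mul_comm (2 * d) y, gcd_Fa hpq]
      simp
    have h1 : pqFib p q (2 * d) ∣ m * pqFib p q d := by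
      rw [← hg, ← Nat.gcd_mul_left]
      exact Nat.dvd_gcd (Dvd.intro_left m rfl) hm
    rw [← hL2] at h1
    exact Nat.dvd_of_mul_dvd_mul_right hFd h1

end Suff



section Nec
variable {p q : ℕ}

lemma LF_double (d : ℕ) (hd : 0 < d) (he : Even d) :
    pqLucas p q d * pqFib p q d = pqFib p q (2 * d) := by
  have := L_mul_even (p := p) (q := q) 0 d (by omega) he
  simp only [F_zero, mul_zero, add_zero] at this
  rw [this, two_mul]

lemma key_lt (hp : 0 < p) (hq : 0 < q) (a d : ℕ) (hd : 2 ≤ d) (he : Even d) (hda : d < a)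
    (h2 : a ≠ 2 * d) (h3 : ¬ (Nat.gcd a d = a - d ∧ Odd a)) :
    pqLucas p q d * pqFib p q (Nat.gcd a d) < pqFib p q a := by
  have hgp : 0 < Nat.gcd a d := Nat.gcd_pos_of_pos_left _ (by omega)
  have hgd : Nat.gcd a d ≤ d := Nat.le_of_dvd (by omega) (Nat.gcd_dvd_right a d)
  have hsub : Nat.gcd a d ∣ a - d := Nat.dvd_sub (Nat.gcd_dvd_left a d) (Nat.gcd_dvd_right a d)
  obtain ⟨m, hm⟩ := hsub
  have hm1 : 1 ≤ m := by
    rcases Nat.eq_zero_or_pos m with rfl | h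
    · simp at hm; omega
    · exact h
  obtain ⟨s, hs⟩ : ∃ s, d = Nat.gcd a d + s := ⟨d - Nat.gcd a d, by omega⟩
  rcases Nat.even_or_odd (Nat.gcd a d) with hge | hgo
  · have h4 := L_mul_even (p := p) (q := q) s (Nat.gcd a d) (by omega) hge
    rw [← hs] at h4
    rcases Nat.eq_zero_or_pos s with rfl | hs0
    · have h5 : Nat.gcd a d = d := by omega
      rw [h5] at hm h4 ⊢
      have hm2 : 2 ≤ m := by
        by_contra hcon
        have : m = 1 := by omega
        subst this
        omega
      have : d * 2 ≤ d * m := Nat.mul_le_mul_left _ hm2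
      have := F_lt hp hq (show 2 ≤ d + d by omega) (show d + d < a by omega)
      omega
    · have h5 : 0 < q ^ Nat.gcd a d * pqFib p q s := Nat.mul_pos (pow_pos hq _) (F_pos hp hs0)
      have h6 : Nat.gcd a d * 1 ≤ Nat.gcd a d * m := Nat.mul_le_mul_left _ hm1
      have h7 : pqFib p q (d + Nat.gcd a d) ≤ pqFib p q a := F_mono hp (by omega)
      omega
  · have h4 := L_mul_odd (p := p) (q := q) s (Nat.gcd a d) hgo
    rw [← hs] at h4
    have hao : Odd a := by
      by_contra hcon
      rw [Nat.not_odd_iff_even] at hcon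
      have : 2 ∣ Nat.gcd a d := Nat.dvd_gcd hcon.two_dvd he.two_dvd
      obtain ⟨y, hy⟩ := hgo
      omega
    have hmo : Odd m := by
      have : Odd (a - d) := Nat.Odd.sub_even hda.le hao he
      rw [hm] at this
      exact (Nat.odd_mul.1 this).2
    have hm3 : 3 ≤ m := by
      obtain ⟨y, rfl⟩ := hmo
      rcases Nat.eq_zero_or_pos y with rfl | hy
      · exact absurd ⟨by omega, hao⟩ h3
      · omega
    have h6 : Nat.gcd a d * 3 ≤ Nat.gcd a d * m := Nat.mul_le_mul_left _ hm3
    have h7 := F_two_lt hp hq (show 2 ≤ d + Nat.gcd a d by omega)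
      (show d + Nat.gcd a d + 2 ≤ a by omega)
    have h8 := F_q_le (p := p) (q := q) (Nat.gcd a d) s
    have h9 : pqFib p q (s + 2 * Nat.gcd a d) ≤ pqFib p q (d + Nat.gcd a d) := F_mono hp (by omega)
    omega

lemma mul_le_of_dvd {A B b : ℕ} (hb : 0 < b) (hA : A ∣ b) (hB : B ∣ b) :
    A * B ≤ b * Nat.gcd A B := by
  rw [← Nat.gcd_mul_lcm, mul_comm]
  exact Nat.mul_le_mul_right _ (Nat.le_of_dvd hb (Nat.lcm_dvd hA hB))

lemma caseA (hp : 0 < p) (hq : 0 < q) (hpq : Nat.gcd p q = 1) (x d i j ci cj : ℕ) (hx : 0 < x)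
    (hd : 2 ≤ d) (he : Even d) (hi : 1 ≤ i) (hij : i < j) (hci : 0 < ci) (hcj : 0 < cj)
    (hL : ci ≤ pqLucas p q d) :
    ci * pqFib p q (x + i * d) ≠ cj * pqFib p q (x + j * d) := by
  intro heq
  have hGi : 0 < pqFib p q (x + i * d) := F_pos hp (by omega)
  have h1 := Nat.mul_le_mul_right (pqFib p q (x + i * d)) hL
  have hid : 1 * d ≤ i * d := Nat.mul_le_mul_right _ hi
  rcases Nat.eq_or_lt_of_le (show i + 1 ≤ j from hij) with rfl | hij2
  · have h2 := mul_le_of_dvd (Nat.mul_pos hci hGi) (Dvd.intro_left ci rfl)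
      (heq ▸ Dvd.intro_left cj rfl : pqFib p q (x + (i + 1) * d) ∣ ci * pqFib p q (x + i * d))
    rw [← F_gcd hpq, show x + (i + 1) * d = d + (x + i * d) by ring, Nat.gcd_add_self_right] at h2
    have h3 : pqFib p q (Nat.gcd (x + i * d) d) ≤ pqFib p q d :=
      F_mono hp (Nat.le_of_dvd (by omega) (Nat.gcd_dvd_right _ _))
    have h4 := LF_double (p := p) (q := q) d (by omega) he
    have h5 := F_lt hp hq (show 2 ≤ 2 * d by omega) (show 2 * d < d + (x + i * d) by omega)
    have h6 : ci * pqFib p q (x + i * d) * pqFib p q (Nat.gcd (x + i * d) d) ≤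
        pqLucas p q d * pqFib p q (x + i * d) * pqFib p q d := Nat.mul_le_mul h1 h3
    have h7 : pqLucas p q d * pqFib p q (x + i * d) * pqFib p q d =
      pqFib p q (x + i * d) * pqFib p q (2 * d) := by rw [← h4]; ring
    have h8 := Nat.mul_lt_mul_of_pos_left h5 hGi
    omega
  · have h2 := L_mul_lt hp hq hd he (show d ≤ x + i * d by omega)
    have h3 : pqFib p q (x + i * d + 2 * d) ≤ pqFib p q (x + j * d) := F_mono hp (by nlinarith)
    have h4 : 1 * pqFib p q (x + j * d) ≤ cj * pqFib p q (x + j * d) := Nat.mul_le_mul_right _ hcj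
    omega

lemma caseB (hp : 0 < p) (hq : 0 < q) (hpq : Nat.gcd p q = 1) (h a d j c0 cj : ℕ) (ha : 0 < a)
    (hd : 2 ≤ d) (he : Even d) (hj : 1 ≤ j) (hc0 : 0 < c0) (hcj : 0 < cj)
    (hkey : pqLucas p q d * pqFib p q (Nat.gcd a d) < pqFib p q a)
    (hcg : c0 * pqFib p q (Nat.gcd a d) ≤ pqFib p q (h * a + d))
    (hnd : ¬ pqFib p q a ∣ pqFib p q (h * a + j * d))
    (heq : c0 * pqFib p q a = cj * pqFib p q (h * a + j * d)) :
    (cj ≤ pqLucas p q d → False) ∧ (2 ≤ j → j * d ∣ a ∧ 2 * (j * d) ≤ a) := by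
  have hFa := F_pos (q := q) hp ha
  have hFg : 0 < pqFib p q (Nat.gcd a d) := F_pos hp (Nat.gcd_pos_of_pos_left _ ha)
  have hjd : 1 * d ≤ j * d := Nat.mul_le_mul_right _ hj
  have hGj : 0 < pqFib p q (h * a + j * d) := F_pos hp (by omega)
  have h1 := mul_le_of_dvd (Nat.mul_pos hc0 hFa) (Dvd.intro_left c0 rfl)
      (heq ▸ Dvd.intro_left cj rfl : pqFib p q (h * a + j * d) ∣ c0 * pqFib p q a)
  rw [gcd_Fa hpq] at h1
  have hdv : 2 ≤ j → j * d ∣ a ∧ 2 * (j * d) ≤ a := by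
    intro hj2
    have h2 : pqFib p q (h * a + j * d) ≤ c0 * pqFib p q (Nat.gcd a (j * d)) := by
      refine Nat.le_of_mul_le_mul_left (c := pqFib p q a) ?_ hFa
      calc _ ≤ _ := h1
        _ = _ := by ring
    have h3 : pqFib p q (h * a + j * d) ≤ pqFib p q (h * a + d) * pqFib p q (Nat.gcd a (j * d)) := by
      refine h2.trans (Nat.mul_le_mul_right _ ?_)
      nlinarith
    obtain ⟨j', rfl⟩ : ∃ j', j = j' + 1 := ⟨j - 1, by omega⟩
    have hj'd : 1 * d ≤ j' * d := Nat.mul_le_mul_right _ (by omega)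
    have h4 := F_mul_le (p := p) (q := q) (h * a + d - 1) (j' * d)
    rw [show h * a + d - 1 + 1 = h * a + d by omega,
      show h * a + d - 1 + j' * d + 1 = h * a + (j' + 1) * d by
        rw [add_mul, one_mul]; omega] at h4
    have hG1 : 0 < pqFib p q (h * a + d) := F_pos hp (by omega)
    have h5 : pqFib p q (j' * d + 1) ≤ pqFib p q (Nat.gcd a ((j' + 1) * d)) :=
      Nat.le_of_mul_le_mul_left (h4.trans h3) hG1
    have h6 : j' * d < Nat.gcd a ((j' + 1) * d) := by
      by_contra hcon
      have h7 : pqFib p q (Nat.gcd a ((j' + 1) * d)) ≤ pqFib p q (j' * d) := F_mono hp (by omega)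
      have := F_lt hp hq (show 2 ≤ j' * d by omega) (Nat.lt_succ_self (j' * d))
      simp only [Nat.succ_eq_add_one] at this
      omega
    have h7 : Nat.gcd a ((j' + 1) * d) = (j' + 1) * d := by
      obtain ⟨m, hm⟩ := Nat.gcd_dvd_right a ((j' + 1) * d)
      have hm1 : m < 2 := by
        by_contra hcon
        have : Nat.gcd a ((j' + 1) * d) * 2 ≤ Nat.gcd a ((j' + 1) * d) * m :=
          Nat.mul_le_mul_left _ (by omega)
        rw [← hm, add_mul, one_mul] at this
        rw [add_mul, one_mul] at h6
        omega
      interval_cases m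
      · omega
      · omega
    have h8 : (j' + 1) * d ∣ a := h7 ▸ Nat.gcd_dvd_left a ((j' + 1) * d)
    refine ⟨h8, ?_⟩
    obtain ⟨m, hm⟩ := h8
    have : 2 ≤ m := by
      by_contra hcon
      have hm1 : m < 2 := by omega
      interval_cases m
      · omega
      · apply hnd
        apply F_dvd hpq
        exact dvd_add (Dvd.intro_left h rfl) (by rw [hm, mul_one])
    rw [hm, mul_comm 2]
    exact Nat.mul_le_mul_left _ this
  refine ⟨fun hL => ?_, hdv⟩
  have h2 : pqFib p q a ≤ pqLucas p q d * pqFib p q (Nat.gcd a (j * d)) := by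
    refine Nat.le_of_mul_le_mul_right (c := pqFib p q (h * a + j * d)) ?_ hGj
    calc _ ≤ _ := h1
      _ = cj * (pqFib p q (h * a + j * d) * pqFib p q (Nat.gcd a (j * d))) := by rw [heq]; ring
      _ ≤ pqLucas p q d * (pqFib p q (h * a + j * d) * pqFib p q (Nat.gcd a (j * d))) :=
        Nat.mul_le_mul_right _ hL
      _ = _ := by ring
  rcases Nat.eq_or_lt_of_le hj with rfl | hj2
  · rw [one_mul] at h2
    omega
  · obtain ⟨h3, h4⟩ := hdv hj2
    rw [Nat.gcd_eq_right h3] at h2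
    have h5 := L_mul_lt hp hq hd he (show d ≤ j * d by omega)
    have h6 : pqFib p q (j * d + 2 * d) ≤ pqFib p q a := F_mono hp (by nlinarith)
    omega

lemma crit_le {n : ℕ} (D : Fin n → ℕ) (i : Fin n) (c L : ℕ) (hc : IsCrit D i c)
    (w : Fin n →₀ ℕ) (hw : SSupp D w) (hwt : Finsupp.weight D w = L * D i) (hlt : w i < L) :
    c ≤ L := by
  have : c ≤ L - w i := by
    refine hc.2.2 _ (by omega) ⟨w.erase i, ?_, by simp, ?_⟩
    · intro l hl
      by_cases hli : l = i
      · simp [hli]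
      · rw [Finsupp.erase_ne hli]; exact hw l hl
    · have h1 : Finsupp.weight D w = w i * D i + Finsupp.weight D (w.erase i) := by
        conv_lhs => rw [← Finsupp.single_add_erase i w]
        rw [map_add, Finsupp.weight_single, smul_eq_mul]
      rw [Nat.sub_mul]; omega
  omega

end Nec



section Fibre
variable {p q : ℕ}

lemma exists_U (hpq : Nat.gcd p q = 1) (d : ℕ) : ∃ U : ℕ → ℕ, ∀ i, pqFib p q (i * d) = pqFib p q d * U i :=
  ⟨fun i => pqFib p q (i * d) / pqFib p q d, fun i =>
    (Nat.mul_div_cancel' (F_dvd hpq (Dvd.intro_left i rfl))).symm⟩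

lemma L_two_le (hp : 0 < p) (hq : 0 < q) (d : ℕ) (hd : 2 ≤ d) : 2 ≤ pqLucas p q d := by
  obtain ⟨e, rfl⟩ : ∃ e, d = e + 1 := ⟨d - 1, by omega⟩
  rw [L_eq]
  have h1 : 0 < pqFib p q (e + 2) := F_pos hp (by omega)
  have h2 : 0 < q * pqFib p q e := Nat.mul_pos hq (F_pos hp (by omega))
  omega

lemma W_aux (A F U W : ℕ) (hF : 0 < F) (hd : (A : ℤ) ∣ ((W : ℤ) - U) * F) (hne : W ≠ U)
    (h3 : F * U < A) : A ≤ F * W := by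
  rcases lt_or_gt_of_ne hne with hlt | hgt
  · exfalso
    obtain ⟨e, rfl⟩ := Nat.exists_eq_add_of_lt hlt
    have h1 : A ∣ (e + 1) * F := by
      rw [← dvd_neg] at hd
      have : -(((W : ℤ) - (W + e + 1 : ℕ)) * F) = ((e + 1) * F : ℕ) := by push_cast; ring
      rw [this] at hd
      exact_mod_cast hd
    have h2 := Nat.le_of_dvd (by positivity) h1
    nlinarith [Nat.zero_le (F * W)]
  · obtain ⟨e, rfl⟩ := Nat.exists_eq_add_of_lt hgt
    have h1 : A ∣ (e + 1) * F := by
      have : (((U + e + 1 : ℕ) : ℤ) - U) * F = ((e + 1) * F : ℕ) := by push_cast; ring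
      rw [this] at hd
      exact_mod_cast hd
    have h2 := Nat.le_of_dvd (by positivity) h1
    nlinarith [Nat.zero_le (F * U)]

lemma fibre_big (hp : 0 < p) (hq : 0 < q) (hpq : Nat.gcd p q = 1) (h a d : ℕ) (hh : 0 < h)
    (hd : 2 ≤ d) (he : Even d) (n : ℕ) (hn : 4 ≤ n) (hNa : 2 * ((n - 1) * d) ≤ a)
    (D : Fin n → ℕ) (hDi : ∀ i : Fin n, 1 ≤ (i : ℕ) → D i = pqFib p q (h * a + (i : ℕ) * d))
    (U : ℕ → ℕ) (hU : ∀ i, pqFib p q (i * d) = pqFib p q d * U i) (z : Fin n →₀ ℕ)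
    (hz : Finsupp.weight D z ≤ U 3 * pqFib p q (h * a + d))
    (hbig : pqFib p q a ≤ pqFib p q d * Finsupp.weight (fun i : Fin n => U i) z) : False := by
  obtain ⟨N, rfl⟩ : ∃ N, n = N + 1 := ⟨n - 1, by omega⟩
  simp only [Nat.add_sub_cancel] at hNa
  have hFd : 0 < pqFib p q d := F_pos hp (by omega)
  have h3N : 3 * d ≤ N * d := Nat.mul_le_mul_right _ (by omega)
  have hle : ∀ i : Fin (N + 1), pqFib p q (h * a + N * d) * (pqFib p q d * U i) ≤
      D i * pqFib p q (N * d) := by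
    intro i
    rw [← hU]
    rcases Nat.eq_zero_or_pos (i : ℕ) with h0 | h0
    · simp [h0, F_zero]
    · rw [hDi i h0]
      obtain ⟨e, he'⟩ : ∃ e, N = (i : ℕ) + e := ⟨N - i, by omega⟩
      have := F_vajda_even (p := p) (q := q) (i * d) (h * a) (e * d) (he.mul_left _)
      rw [show (i : ℕ) * d + h * a + e * d = h * a + N * d by linear_combination d * he'.symm,
        show (i : ℕ) * d + e * d = N * d by linear_combination d * he'.symm,
        show (i : ℕ) * d + h * a = h * a + i * d by ring] at this
      rw [this, mul_comm]; omega
  have hsum : pqFib p q (h * a + N * d) * (pqFib p q d * Finsupp.weight (fun i : Fin (N + 1) => U i) z) ≤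
      Finsupp.weight D z * pqFib p q (N * d) := by
    rw [weight_sum, weight_sum, Finset.mul_sum, Finset.mul_sum, Finset.sum_mul]
    refine Finset.sum_le_sum fun i _ => ?_
    calc _ = z i * (pqFib p q (h * a + N * d) * (pqFib p q d * U i)) := by ring
      _ ≤ z i * (D i * pqFib p q (N * d)) := Nat.mul_le_mul_left _ (hle i)
      _ = _ := by ring
  have h1 : pqFib p q (N * d) * pqFib p q (N * d + 1) ≤ pqFib p q a := by
    have h2 := F_mul_le (p := p) (q := q) (N * d - 1) (N * d)
    rw [show N * d - 1 + 1 = N * d by omega, show N * d - 1 + N * d + 1 = 2 * (N * d) by omega] at h2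
    exact h2.trans (F_mono hp hNa)
  have hFN : 0 < pqFib p q (N * d) := F_pos hp (by omega)
  have h4 : pqFib p q (h * a + N * d) * pqFib p q (N * d + 1) ≤ U 3 * pqFib p q (h * a + d) := by
    refine Nat.le_of_mul_le_mul_right (c := pqFib p q (N * d)) ?_ hFN
    calc _ = pqFib p q (h * a + N * d) * (pqFib p q (N * d) * pqFib p q (N * d + 1)) := by ring
      _ ≤ pqFib p q (h * a + N * d) * (pqFib p q d * Finsupp.weight (fun i : Fin (N + 1) => U i) z) :=
        Nat.mul_le_mul_left _ (h1.trans hbig)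
      _ ≤ _ := hsum
      _ ≤ _ := Nat.mul_le_mul_right _ hz
  have h5 : U 3 ≤ pqFib p q (N * d + 1) := by
    have h6 : pqFib p q (3 * d) ≤ pqFib p q (N * d + 1) := F_mono hp (by omega)
    rw [hU] at h6
    nlinarith
  have h6 : pqFib p q (h * a + d) < pqFib p q (h * a + N * d) := F_lt hp hq (by omega) (by omega)
  have h7 : 0 < pqFib p q (N * d + 1) := F_pos hp (by omega)
  nlinarith

set_option maxHeartbeats 800000 in
lemma fibre_main (hp : 0 < p) (hq : 0 < q) (hpq : Nat.gcd p q = 1) (h a d : ℕ) (hh : 0 < h)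
    (hd : 2 ≤ d) (he : Even d) (n : ℕ) (hn : 4 ≤ n) (hdv : (n - 1) * d ∣ a)
    (hNa : 2 * ((n - 1) * d) ≤ a)
    (D : Fin n → ℕ) (hD0 : D ⟨0, by omega⟩ = pqFib p q a)
    (hDi : ∀ i : Fin n, 1 ≤ (i : ℕ) → D i = pqFib p q (h * a + (i : ℕ) * d)) :
    ∃ w v : Fin n →₀ ℕ, Finsupp.weight D w = Finsupp.weight D v ∧
      (∀ l, w l = 0 ∨ v l = 0) ∧ (∀ i m, w ≠ Finsupp.single i m) ∧
      (∀ i m, v ≠ Finsupp.single i m) ∧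
      (∀ u, Finsupp.weight D u = Finsupp.weight D w → u = w ∨ u = v) := by
  classical
  obtain ⟨U, hU⟩ := exists_U (p := p) (q := q) hpq d
  have h3n : 3 * d ≤ (n - 1) * d := Nat.mul_le_mul_right _ (by omega)
  have ha : 0 < a := by omega
  have hha : 0 < h * a := Nat.mul_pos hh ha
  have hda : d ∣ a := dvd_trans (Dvd.intro_left _ rfl) hdv
  have hFd : 0 < pqFib p q d := F_pos hp (by omega)
  have hFa : 0 < pqFib p q a := F_pos hp (by omega)
  have hG0 : 0 < pqFib p q (h * a) := F_pos hp hha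
  have hQ : 0 < q ^ d := pow_pos hq d
  have hL2 := L_two_le hp hq d hd
  have hU0 : U 0 = 0 := by
    have := hU 0
    simp [F_zero] at this
    omega
  have hU1 : U 1 = 1 := by
    have := hU 1
    rw [one_mul] at this
    exact Nat.eq_of_mul_eq_mul_left hFd (by omega)
  have hU2 : U 2 = pqLucas p q d := by
    have h1 := LF_double (p := p) (q := q) d (by omega) he
    rw [hU, mul_comm] at h1
    exact (Nat.eq_of_mul_eq_mul_left hFd h1).symm
  have hU3 : U 3 + q ^ d = pqLucas p q d * pqLucas p q d := by
    have h1 := L_rec_even (p := p) (q := q) d d (by omega) he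
    rw [show d + 2 * d = 3 * d by ring, show d + d = 2 * d by ring, hU, hU, hU2] at h1
    apply Nat.eq_of_mul_eq_mul_left hFd
    linear_combination h1
  have hUlt : ∀ i, 4 ≤ i → U 3 < U i := by
    intro i hi
    have h4 : 4 * d ≤ i * d := Nat.mul_le_mul_right _ hi
    have := F_lt hp hq (show 2 ≤ 3 * d by omega) (show 3 * d < i * d by omega)
    rw [hU, hU] at this
    exact Nat.lt_of_mul_lt_mul_left this
  have hLU : pqLucas p q d ≤ U 3 := by
    rw [← hU2]
    have : pqFib p q (2 * d) ≤ pqFib p q (3 * d) := F_mono hp (by omega)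
    rw [hU, hU] at this
    exact Nat.le_of_mul_le_mul_left this hFd
  have hr1 := L_rec_even (p := p) (q := q) (h * a) d (by omega) he
  have hr2 := L_rec_even (p := p) (q := q) (h * a + d) d (by omega) he
  rw [show h * a + d + 2 * d = h * a + 3 * d by ring, show h * a + d + d = h * a + 2 * d by ring] at hr2
  obtain ⟨k0, hk0⟩ := F_dvd (p := p) (q := q) hpq (Dvd.intro_left h rfl : a ∣ h * a)
  have hk0p : 0 < k0 := by
    rcases Nat.eq_zero_or_pos k0 with rfl | h
    · omega
    · exact h
  have hcong : ∀ i : Fin n, ∃ s t, D i + pqFib p q a * s = U i * pqFib p q (h * a + d) + pqFib p q a * t := by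
    intro i
    by_cases hi : (i : ℕ) = 0
    · refine ⟨0, 1, ?_⟩
      rw [show i = ⟨0, by omega⟩ from Fin.ext hi, hD0]
      simp [hU0]
    · obtain ⟨j, hj⟩ : ∃ j, (i : ℕ) = j + 1 := ⟨i - 1, by omega⟩
      refine ⟨q ^ d * U j * k0, 0, ?_⟩
      rw [hDi i (by omega), hj]
      have := F_vajda_even (p := p) (q := q) d (h * a) (j * d) he
      rw [show d + j * d = (j + 1) * d by ring, show d + h * a + j * d = h * a + (j + 1) * d by ring,
        hU (j + 1), hU j, hk0, show d + h * a = h * a + d by ring] at this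
      apply Nat.eq_of_mul_eq_mul_left hFd
      linear_combination this.symm
  choose S T hST using hcong
  have hcongz : ∀ z : Fin n →₀ ℕ, ∃ s t, Finsupp.weight D z + pqFib p q a * s =
      Finsupp.weight (fun i : Fin n => U i) z * pqFib p q (h * a + d) + pqFib p q a * t := by
    intro z
    refine ⟨∑ i, z i * S i, ∑ i, z i * T i, ?_⟩
    rw [weight_sum, weight_sum, Finset.mul_sum, Finset.mul_sum, Finset.sum_mul,
      ← Finset.sum_add_distrib, ← Finset.sum_add_distrib]
    refine Finset.sum_congr rfl fun i _ => ?_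
    linear_combination z i * hST i
  have hgcd : Nat.gcd (pqFib p q a) (pqFib p q (h * a + d)) = pqFib p q d := by
    rw [gcd_Fa hpq, Nat.gcd_eq_right hda]
  have hbig := fun z => fibre_big hp hq hpq h a d hh hd he n hn hNa D hDi U hU z
  have hu1 : 0 < U 3 % pqLucas p q d := by
    rw [Nat.pos_iff_ne_zero]
    intro hcon
    have h1 := Nat.dvd_of_mod_eq_zero hcon
    have h2 : pqLucas p q d ∣ q ^ d :=
      (Nat.dvd_add_right h1).1 (hU3 ▸ Dvd.intro _ rfl)
    have h3 := Nat.Coprime.eq_one_of_dvd ((L_coprime hpq d (by omega)).pow_right d) h2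
    omega
  have hu2 : 0 < U 3 / pqLucas p q d := Nat.div_pos hLU (by omega)
  have hu2L : U 3 / pqLucas p q d < pqLucas p q d := (Nat.div_lt_iff_lt_mul (by omega)).2 (by omega)
  have hu12 := Nat.mod_add_div (U 3) (pqLucas p q d)
  have hu1L := Nat.mod_lt (U 3) (show pqLucas p q d > 0 by omega)
  generalize hLdef : pqLucas p q d = L at *
  generalize U 3 % L = u1 at *
  generalize U 3 / L = u2 at *
  obtain ⟨f, hf⟩ := Nat.exists_eq_add_of_lt hu2L
  generalize hQdef : q ^ d = Q at *
  have hD1 : D ⟨1, by omega⟩ = pqFib p q (h * a + d) := by rw [hDi _ (by simp)]; simp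
  have hD2 : D ⟨2, by omega⟩ = pqFib p q (h * a + 2 * d) := by rw [hDi _ (by simp)]
  have hD3 : D ⟨3, by omega⟩ = pqFib p q (h * a + 3 * d) := by rw [hDi _ (by simp)]
  have hrel : u1 * pqFib p q (h * a + d) + u2 * pqFib p q (h * a + 2 * d) =
      pqFib p q (h * a + 3 * d) + ((f + 1) * Q * k0) * pqFib p q a := by
    have e1 : (f + 1) * Q * k0 * pqFib p q a = (f + 1) * Q * pqFib p q (h * a) := by rw [hk0]; ring
    rw [e1]
    zify at *
    have hf' : (f : ℤ) + 1 = L - u2 := by rw [hf]; ring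
    rw [hf']
    have hU3' : (U 3 : ℤ) = L * L - Q := by linarith
    rw [hU3'] at hu12
    linear_combination (pqFib p q (h * a + d) : ℤ) * hu12 + (u2 - L) * hr1 - hr2
  have hrelle : u1 * pqFib p q (h * a + d) + u2 * pqFib p q (h * a + 2 * d) ≤
      U 3 * pqFib p q (h * a + d) := by
    have e1 : pqFib p q (h * a + 2 * d) ≤ L * pqFib p q (h * a + d) := by omega
    have e2 := Nat.mul_le_mul_left u2 e1
    rw [← hu12, add_mul]
    have e3 : L * u2 * pqFib p q (h * a + d) = u2 * (L * pqFib p q (h * a + d)) := by ring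
    omega
  refine ⟨Finsupp.single ⟨1, by omega⟩ u1 + Finsupp.single ⟨2, by omega⟩ u2,
    Finsupp.single ⟨3, by omega⟩ 1 + Finsupp.single ⟨0, by omega⟩ ((f + 1) * Q * k0), ?_, ?_, ?_, ?_, ?_⟩
  · simp only [map_add, Finsupp.weight_single, smul_eq_mul, hD0, hD1, hD2, hD3, one_mul]
    exact hrel
  · intro l
    simp only [Finsupp.add_apply, Finsupp.single_apply, Fin.ext_iff]
    split_ifs <;> first | omega | simp
  · intro i m hcon
    have e1 := DFunLike.congr_fun hcon ⟨1, by omega⟩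
    have e2 := DFunLike.congr_fun hcon ⟨2, by omega⟩
    simp only [Finsupp.add_apply, Finsupp.single_apply, Fin.ext_iff] at e1 e2
    split_ifs at e1 e2 <;> omega
  · intro i m hcon
    have e1 := DFunLike.congr_fun hcon ⟨3, by omega⟩
    have e2 := DFunLike.congr_fun hcon ⟨0, by omega⟩
    have hpos : 0 < (f + 1) * Q * k0 := by positivity
    generalize (f + 1) * Q * k0 = e at *
    simp only [Finsupp.add_apply, Finsupp.single_apply, Fin.ext_iff] at e1 e2
    split_ifs at e1 e2 <;> omega
  · intro z hz
    simp only [map_add, Finsupp.weight_single, smul_eq_mul, hD1, hD2] at hz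
    have hUz : Finsupp.weight (fun i : Fin n => U i) z = U 3 := by
      by_contra hne
      obtain ⟨s, t, hst⟩ := hcongz z
      have hdvd : (pqFib p q a : ℤ) ∣
          ((Finsupp.weight (fun i : Fin n => U i) z : ℕ) - (U 3 : ℕ) : ℤ) * pqFib p q (h * a + d) := by
        refine ⟨s - t - u2 * Q * k0, ?_⟩
        have e1 : u2 * Q * k0 * pqFib p q a = u2 * Q * pqFib p q (h * a) := by rw [hk0]; ring
        rw [hz] at hst
        zify at hst hr1 hu12 e1
        linear_combination (-1 : ℤ) * hst + (pqFib p q (h * a + d) : ℤ) * hu12 + u2 * hr1 + e1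
      have hdvd2 : (pqFib p q a : ℤ) ∣
          ((Finsupp.weight (fun i : Fin n => U i) z : ℕ) - (U 3 : ℕ) : ℤ) * pqFib p q d := by
        rw [← hgcd]
        rw [← Int.natAbs_dvd_natAbs] at hdvd ⊢
        rw [Int.natAbs_mul, Int.natAbs_natCast, Int.natAbs_natCast] at hdvd ⊢
        rw [← Nat.gcd_mul_left]
        exact Nat.dvd_gcd (Dvd.intro_left _ rfl) hdvd
      have h3a : pqFib p q (3 * d) < pqFib p q a := F_lt hp hq (by omega) (by omega)
      rw [hU] at h3a
      have hnb := hbig z (by rw [hz]; exact hrelle)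
      generalize Finsupp.weight (fun i : Fin n => U i) z = W at *
      exact hnb (W_aux _ _ _ _ hFd hdvd2 hne h3a)
    have hz4 : ∀ i : Fin n, 4 ≤ (i : ℕ) → z i = 0 := by
      intro i hi
      have h1 := le_weight' (fun i : Fin n => U i) z i
      rw [hUz] at h1
      have h2 := hUlt i hi
      by_contra hcon
      have : 1 * U i ≤ z i * U i := Nat.mul_le_mul_right _ (by omega)
      omega
    have hdec : z = Finsupp.single ⟨0, by omega⟩ (z ⟨0, by omega⟩) +
        Finsupp.single ⟨1, by omega⟩ (z ⟨1, by omega⟩) +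
        Finsupp.single ⟨2, by omega⟩ (z ⟨2, by omega⟩) +
        Finsupp.single ⟨3, by omega⟩ (z ⟨3, by omega⟩) := by
      ext i
      simp only [Finsupp.add_apply, Finsupp.single_apply]
      by_cases h0 : (i : ℕ) = 0
      · rw [show i = ⟨0, by omega⟩ from Fin.ext h0]; simp
      by_cases h1 : (i : ℕ) = 1
      · rw [show i = ⟨1, by omega⟩ from Fin.ext h1]; simp
      by_cases h2 : (i : ℕ) = 2
      · rw [show i = ⟨2, by omega⟩ from Fin.ext h2]; simp
      by_cases h3 : (i : ℕ) = 3
      · rw [show i = ⟨3, by omega⟩ from Fin.ext h3]; simp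
      rw [hz4 i (by omega)]
      simp only [Fin.ext_iff]
      split_ifs <;> first | omega | rfl
    generalize z ⟨0, by omega⟩ = z0 at hdec
    generalize z ⟨1, by omega⟩ = z1 at hdec
    generalize z ⟨2, by omega⟩ = z2 at hdec
    generalize z ⟨3, by omega⟩ = z3 at hdec
    rw [hdec] at hz hUz
    simp only [map_add, Finsupp.weight_single, smul_eq_mul, hD0, hD1, hD2, hD3, hU0, hU1, hU2,
      mul_zero, mul_one, zero_add] at hz hUz
    have hz3 : z3 ≤ 1 := by
      by_contra hcon
      have : 2 * U 3 ≤ z3 * U 3 := Nat.mul_le_mul_right _ (by omega)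
      omega
    interval_cases z3
    · left
      simp only [zero_mul, add_zero] at hz hUz
      have hz2 : z2 ≤ u2 := by
        by_contra hcon
        have : L * (u2 + 1) ≤ L * z2 := Nat.mul_le_mul_left _ (by omega)
        rw [mul_add, mul_one, mul_comm L z2] at this
        omega
      obtain ⟨e, rfl⟩ := Nat.exists_eq_add_of_le hz2
      have hz1 : z1 = u1 + e * L := by linear_combination hUz + hu12.symm
      subst hz1
      have h9 : z0 * pqFib p q a + e * (Q * pqFib p q (h * a)) = 0 := by
        linear_combination hz + e * hr1
      have h10 : z0 * pqFib p q a = 0 ∧ e * (Q * pqFib p q (h * a)) = 0 := by omega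
      have h11 : e = 0 := by
        rcases Nat.mul_eq_zero.1 h10.2 with h | h
        · exact h
        · have := Nat.mul_pos hQ hG0; omega
      have h12 : z0 = 0 := by
        rcases Nat.mul_eq_zero.1 h10.1 with h | h
        · exact h
        · omega
      rw [hdec, h11, h12]; simp
    · right
      have hz1 : z1 = 0 := by omega
      have hz2 : z2 * L = 0 := by omega
      have hz2 : z2 = 0 := by
        rcases Nat.mul_eq_zero.1 hz2 with h | h
        · exact h
        · omega
      subst hz1 hz2
      have h9 : z0 = (f + 1) * Q * k0 := by
        apply Nat.eq_of_mul_eq_mul_right hFa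
        omega
      rw [hdec, h9, Finsupp.single_zero, Finsupp.single_zero, add_zero, add_zero, add_comm]

end Fibre



section Final
variable {p q : ℕ}

lemma nec (k : Type*) [Field k] (hp : 0 < p) (hq : 0 < q)
    (hpq : Nat.gcd p q = 1) (h a d : ℕ) (hh : 0 < h)
    (n : ℕ) (hn : 3 ≤ n) (hd : 2 ≤ d) (he : Even d) (hda : d < a)
    (h2 : a ≠ 2 * d) (h3 : ¬ (Nat.gcd a d = a - d ∧ Odd a)) (h4 : ¬ (n = 3 ∧ 2 * d ∣ a))
    (D : Fin n → ℕ) (hD0 : D ⟨0, by omega⟩ = pqFib p q a)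
    (hDi : ∀ i : Fin n, 1 ≤ (i : ℕ) → D i = pqFib p q (h * a + (i : ℕ) * d)) :
    ¬ IsCI k D := by
  have hkey := key_lt (p := p) (q := q) hp hq a d hd he hda h2 h3
  have ha : 0 < a := by omega
  have haha : a ≤ h * a := Nat.le_mul_of_pos_left _ hh
  have hgp : 0 < Nat.gcd a d := Nat.gcd_pos_of_pos_left _ ha
  have hFg := F_pos (q := q) hp hgp
  have hL2 := L_two_le hp hq d hd
  have hFa := F_pos (q := q) hp ha
  have hmono : ∀ i j : Fin n, (i : ℕ) < j → D i < D j := by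
    intro i j hij
    have hjd : ((i : ℕ) + 1) * d ≤ j * d := Nat.mul_le_mul_right _ hij
    rw [add_mul, one_mul] at hjd
    rw [hDi j (by omega)]
    by_cases hi : (i : ℕ) = 0
    · rw [show i = ⟨0, by omega⟩ from Fin.ext hi, hD0]
      exact F_lt hp hq (by omega) (by omega)
    · rw [hDi i (by omega)]
      exact F_lt hp hq (by omega) (by omega)
  have hD : ∀ i, 0 < D i := by
    intro i
    by_cases hi : (i : ℕ) = 0
    · rw [show i = ⟨0, by omega⟩ from Fin.ext hi, hD0]; exact hFa
    · rw [hDi i (by omega)]; exact F_pos hp (by omega)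
  have hinj : Function.Injective D := by
    intro i j hij
    rcases lt_trichotomy (i : ℕ) j with hlt | heq | hgt
    · have := hmono i j hlt; omega
    · exact Fin.ext heq
    · have := hmono j i hgt; omega
  have hsmall : ∀ (u : Fin n →₀ ℕ) (i : Fin n), Finsupp.weight D u < D i → u i = 0 := by
    intro u i hlt
    have := le_weight' D u i
    by_contra hcon
    have h1 : 1 * D i ≤ u i * D i := Nat.mul_le_mul_right _ (by omega)
    omega
  set i0 : Fin n := ⟨0, by omega⟩ with hi0
  set i1 : Fin n := ⟨1, by omega⟩ with hi1
  have h01 : i0 ≠ i1 := by simp [hi0, hi1]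
  have hG1 : D i1 = pqFib p q (h * a + d) := by rw [hDi i1 (by simp [hi1])]; simp [hi1]
  have hN0 : ¬ RedGen D i0 := by
    rintro ⟨u, hu, hw⟩
    have hz : u = 0 := by
      ext i
      by_cases hi : i = i0
      · rw [hi, hu]; rfl
      · refine hsmall u i ?_
        rw [hw]
        apply hmono
        have : (i : ℕ) ≠ 0 := fun hc => hi (Fin.ext hc)
        simp only [hi0]; omega
    rw [hz, map_zero] at hw
    have := hD i0
    omega
  have hN1 : ¬ RedGen D i1 := by
    rintro ⟨u, hu, hw⟩
    have hz : u = Finsupp.single i0 (u i0) := by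
      ext i
      rw [Finsupp.single_apply]
      split_ifs with hi
      · rw [hi]
      by_cases hii : i = i1
      · rw [hii, hu]
      · refine hsmall u i ?_
        rw [hw]
        apply hmono
        have : (i : ℕ) ≠ 0 := fun hc => hi (Fin.ext hc).symm
        have : (i : ℕ) ≠ 1 := fun hc => hii (Fin.ext hc)
        simp only [hi1]; omega
    rw [hz, Finsupp.weight_single, smul_eq_mul, hD0, hG1] at hw
    have h1 : pqFib p q a ∣ pqFib p q (h * a + d) := ⟨u i0, by rw [← hw, mul_comm]⟩
    have h5 := gcd_Fa hpq h a d
    rw [Nat.gcd_eq_left h1] at h5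
    have h6 : 2 * pqFib p q (Nat.gcd a d) ≤ pqLucas p q d * pqFib p q (Nat.gcd a d) :=
      Nat.mul_le_mul_right _ hL2
    omega
  have hSs : ∀ i m, ¬ RedGen D i → SSupp D (Finsupp.single i m) := by
    intro i m hi l hl
    rw [Finsupp.single_apply, if_neg]
    rintro rfl
    exact hi hl
  obtain ⟨r, hr⟩ := exists_r D hD hinj
  have hcex : ∀ i, ∃ c, IsCrit D i c := by
    intro i
    by_cases hi : i = i0
    · exact crit_exists D hD i i1 (hi ▸ h01) hN1
    · exact crit_exists D hD i i0 hi hN0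
  choose c hc using hcex
  have hcL : ∀ i : Fin n, 1 ≤ (i : ℕ) → (i : ℕ) + 1 < n → c i ≤ pqLucas p q d := by
    intro i hi1' hin
    obtain ⟨j, hj⟩ : ∃ j, (i : ℕ) = j + 1 := ⟨i - 1, by omega⟩
    obtain ⟨u, huS, hui, huw⟩ : ∃ u, SSupp D u ∧ u i = 0 ∧
        Finsupp.weight D u = pqFib p q (h * a + j * d) := by
      by_cases hj0 : j = 0
      · obtain ⟨k0, hk0⟩ := F_dvd (p := p) (q := q) hpq (Dvd.intro_left h rfl : a ∣ h * a)
        refine ⟨Finsupp.single i0 k0, hSs _ _ hN0, ?_, ?_⟩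
        · rw [Finsupp.single_apply, if_neg]
          intro hcon
          rw [← hcon] at hi1'
          simp [hi0] at hi1'
        · rw [Finsupp.weight_single, smul_eq_mul, hD0, hj0, zero_mul, add_zero, hk0, mul_comm]
      · have hjw : Finsupp.weight D (r ⟨j, by omega⟩) = D ⟨j, by omega⟩ := (hr ⟨j, by omega⟩).2.1
        refine ⟨r ⟨j, by omega⟩, (hr _).1, hsmall _ _ ?_, ?_⟩
        · rw [hjw]
          apply hmono
          simp only; omega
        · rw [hjw, hDi _ (by simp only; omega)]
    have hrec := L_rec_even (p := p) (q := q) (h * a + j * d) d (by omega) he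
    rw [show h * a + j * d + d = h * a + (j + 1) * d by ring,
      show h * a + j * d + 2 * d = h * a + (j + 2) * d by ring] at hrec
    have hpos : 0 < q ^ d * pqFib p q (h * a + j * d) :=
      Nat.mul_pos (pow_pos hq _) (F_pos hp (by omega))
    have hi2 : (j + 2) < n := by omega
    have hw2 : Finsupp.weight D (r ⟨j + 2, hi2⟩) = pqFib p q (h * a + (j + 2) * d) := by
      rw [(hr _).2.1, hDi _ (by simp)]
    have hDii : D i = pqFib p q (h * a + (j + 1) * d) := by rw [hDi i hi1', hj]
    refine crit_le D i (c i) _ (hc i) (q ^ d • u + r ⟨j + 2, hi2⟩) ?_ ?_ ?_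
    · intro l hl
      simp [huS l hl, (hr ⟨j + 2, hi2⟩).1 l hl]
    · rw [map_add, map_nsmul, huw, hw2, hDii, smul_eq_mul]
      omega
    · simp only [Finsupp.add_apply, Finsupp.smul_apply, hui, smul_zero, zero_add]
      have h5 := le_weight' D (r ⟨j + 2, hi2⟩) i
      rw [hw2, hDii] at h5
      by_contra hcon
      have h6 := Nat.mul_le_mul_right (pqFib p q (h * a + (j + 1) * d)) (not_lt.1 hcon)
      omega
  have hc0 : c i0 * pqFib p q (Nat.gcd a d) ≤ pqFib p q (h * a + d) := by
    obtain ⟨M, hM⟩ := F_dvd (p := p) (q := q) hpq (Nat.gcd_dvd_left a d)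
    obtain ⟨k1, hk1⟩ : pqFib p q (Nat.gcd a d) ∣ pqFib p q (h * a + d) :=
      F_dvd hpq (dvd_add ((Nat.gcd_dvd_left a d).mul_left _) (Nat.gcd_dvd_right a d))
    have hG1p := hD i1
    rw [hG1] at hG1p
    have hle : c i0 ≤ k1 := by
      refine (hc i0).2.2 k1 ?_ ⟨Finsupp.single i1 M, hSs _ _ hN1, ?_, ?_⟩
      · rcases Nat.eq_zero_or_pos k1 with rfl | hpos
        · simp at hk1; omega
        · exact hpos
      · rw [Finsupp.single_apply, if_neg h01.symm]
      · rw [Finsupp.weight_single, smul_eq_mul, hD0, hG1, hk1, hM]; ring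
    rw [hk1, mul_comm]
    exact Nat.mul_le_mul_left _ hle
  have hA : ∀ i j : Fin n, 1 ≤ (i : ℕ) → (i : ℕ) < j → c i * D i ≠ c j * D j := by
    intro i j hi hij
    rw [hDi i hi, hDi j (by omega)]
    exact caseA hp hq hpq (h * a) d i j (c i) (c j) (by omega) hd he hi hij (hc i).1 (hc j).1
      (hcL i hi (by omega))
  have hA' : ∀ i j : Fin n, 1 ≤ (i : ℕ) → 1 ≤ (j : ℕ) → i ≠ j → c i * D i ≠ c j * D j := by
    intro i j hi hj hij
    rcases lt_trichotomy (i : ℕ) j with hlt | heq | hgt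
    · exact hA i j hi hlt
    · exact absurd (Fin.ext heq) hij
    · exact (hA j i hj hgt).symm
  have hne0 : ∀ i : Fin n, i ≠ i0 → 1 ≤ (i : ℕ) := by
    intro i hi
    have : (i : ℕ) ≠ 0 := fun hc => hi (Fin.ext hc)
    omega
  have hB : ∀ j : Fin n, 1 ≤ (j : ℕ) → ¬ RedGen D j → c i0 * D i0 = c j * D j →
      4 ≤ n ∧ (n - 1) * d ∣ a ∧ 2 * ((n - 1) * d) ≤ a := by
    intro j hj hjR heq
    rw [hD0, hDi j hj] at heq
    have hnd : ¬ pqFib p q a ∣ pqFib p q (h * a + j * d) := by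
      rintro ⟨m, hm⟩
      apply hjR
      refine ⟨Finsupp.single i0 m, ?_, ?_⟩
      · rw [Finsupp.single_apply, if_neg]
        intro hcon
        rw [← hcon] at hj
        simp [hi0] at hj
      · rw [Finsupp.weight_single, smul_eq_mul, hD0, hDi j hj, hm, mul_comm]
    obtain ⟨hb1, hb2⟩ := caseB hp hq hpq h a d j (c i0) (c j) ha hd he hj (hc i0).1 (hc j).1 hkey
      hc0 hnd heq
    have hjn : (j : ℕ) = n - 1 := by
      by_contra hcon
      exact hb1 (hcL j hj (by omega))
    obtain ⟨hb3, hb4⟩ := hb2 (by omega)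
    rw [hjn] at hb3 hb4
    refine ⟨?_, hb3, hb4⟩
    by_contra hcon
    have hn3 : n = 3 := by omega
    apply h4
    rw [hn3] at hb3
    exact ⟨hn3, by simpa using hb3⟩
  by_cases hcase : 4 ≤ n ∧ (n - 1) * d ∣ a ∧ 2 * ((n - 1) * d) ≤ a
  · obtain ⟨hn4, hdv, hle⟩ := hcase
    obtain ⟨w, v, e1, e2, e3, e4, e5⟩ := fibre_main hp hq hpq h a d hh hd he n hn4 hdv hle D hD0 hDi
    exact not_CI_mode2 k D hD r hr c hc i0 hN0
      (fun i j _ _ hi hj hij => hA' i j (hne0 i hi) (hne0 j hj) hij) w v e1 e2 e3 e4 e5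
  · refine not_CI_mode1 k D hD r hr c hc i0 hN0 ?_
    intro i j hiR hjR hij
    by_cases hi : i = i0
    · have hj : j ≠ i0 := fun hc => hij (hi.trans hc.symm)
      rw [hi]
      exact fun heq => hcase (hB j (hne0 j hj) hjR heq)
    by_cases hj : j = i0
    · rw [hj]
      exact fun heq => hcase (hB i (hne0 i hi) hiR heq.symm)
    exact hA' i j (hne0 i hi) (hne0 j hj) hij

end Final



/-- For relatively prime `p, q ∈ ℤ⁺`, the `(p,q)`-Fibonacci sequence
`F`, positive integers `h, a, d` and `n ≥ 3`, set `d₁ = F_a` and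
`d_i = F_{h·a + (i−1)·d}` for `2 ≤ i ≤ n`. Then `I_A` is a complete intersection
iff (a) `d` is odd, (b) `d ≥ a`, (c) `a = 2d`, (d) `gcd(a,d) = a − d` and `a` is
odd, or (e) `n = 3` and `2d ∣ a`. -/
theorem stmt4 (k : Type*) [Field k] (p q : ℕ) (hp : 0 < p) (hq : 0 < q)
    (hpq : Nat.gcd p q = 1) (h a d : ℕ) (hh : 0 < h) (ha : 0 < a) (hd : 0 < d)
    (n : ℕ) (hn : 3 ≤ n) :
    IsCI k (fun i : Fin n =>
        if (i : ℕ) = 0 then pqFib p q a else pqFib p q (h * a + (i : ℕ) * d)) ↔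
      (Odd d ∨ a ≤ d ∨ a = 2 * d ∨ (Nat.gcd a d = a - d ∧ Odd a) ∨
        (n = 3 ∧ 2 * d ∣ a)) := by
  constructor
  · intro hCI
    by_contra hcon
    push Not at hcon
    obtain ⟨h1, h2, h3, h4, h5⟩ := hcon
    have he := Nat.not_odd_iff_even.1 h1
    have hd2 : 2 ≤ d := by obtain ⟨e, rfl⟩ := he; omega
    refine nec k hp hq hpq h a d hh n hn hd2 he (by omega) h3 (fun hc => h4 hc.1 hc.2)
      (fun hc => h5 hc.1 hc.2) _ ?_ ?_ hCI
    · simp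
    · intro i hi
      rw [if_neg (by omega)]
  · intro hc
    exact suff k hp hq hpq h a d hh ha hd n hn hc
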